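/- Let F ⊂ ℝⁿ be a compact convex set of volume 1 and let P be a non-constant polynomial on ℝⁿ of degree at most d. Then for all q > 0 and all r with 0 < r < 1/d, the inverse Hölder inequality holds: (∫_F |P|^q dx)^{1/q} · (∫_F |P|^{−r} dx)^{1/r} ≤ (12·max{1, qd})^d / (1−rd)^{1/r}. -/

import Mathlib

open MeasureTheory

section

open Set
open scoped ENNReal Pointwise

theorem IsCompact.volume_add_le {K L C : Set ℝ} (hK : IsCompact K) (hL : IsCompact L)
    (hK0 : K.Nonempty) (hL0 : L.Nonempty) (hC : K + L ⊆ C) :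
    volume K + volume L ≤ volume C := by
  obtain ⟨a, haK, ha⟩ := hK.exists_isGreatest hK0
  obtain ⟨b, hbL, hb⟩ := hL.exists_isLeast hL0
  have e1 : volume ((· + b) '' K) = volume K := by
    rw [Set.image_add_right, measure_preimage_add_right]
  have e2 : volume ((a + ·) '' L) = volume L := by
    rw [Set.image_add_left, measure_preimage_add]
  have hd : AEDisjoint volume ((· + b) '' K) ((a + ·) '' L) := by
    refine measure_mono_null (t := {a + b}) ?_ (by simp)
    rintro z ⟨⟨x, hx, rfl⟩, ⟨y, hy, hxy⟩⟩
    have h1 := ha hx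
    have h2 := hb hy
    simp only [mem_singleton_iff] at *
    linarith
  have hm : NullMeasurableSet ((a + ·) '' L) volume :=
    ((hL.image (by fun_prop)).isClosed.measurableSet).nullMeasurableSet
  rw [← e1, ← e2, ← measure_union₀ hm hd]
  refine measure_mono (union_subset ?_ ?_)
  · rintro _ ⟨x, hx, rfl⟩
    exact hC (add_mem_add hx hbL)
  · rintro _ ⟨x, hx, rfl⟩
    exact hC (add_mem_add haK hx)

/-- The one-dimensional Brunn-Minkowski inequality. -/
theorem volume_add_le_of_add_subset {A B C : Set ℝ} (hA : MeasurableSet A)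
    (hB : MeasurableSet B) (hA0 : A.Nonempty) (hB0 : B.Nonempty) (hC : A + B ⊆ C) :
    volume A + volume B ≤ volume C := by
  obtain ⟨x, hx⟩ := hA0
  obtain ⟨y, hy⟩ := hB0
  rw [hA.measure_eq_iSup_isCompact, hB.measure_eq_iSup_isCompact]
  have key : ∀ K ⊆ A, IsCompact K → ∀ L ⊆ B, IsCompact L →
      volume K + volume L ≤ volume C := by
    intro K hKA hK L hLB hL
    calc volume K + volume L ≤ volume (insert x K) + volume (insert y L) := by
          gcongr <;> exact subset_insert _ _
      _ ≤ volume C := (hK.insert x).volume_add_le (hL.insert y) (insert_nonempty _ _)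
          (insert_nonempty _ _) ((add_subset_add (insert_subset hx hKA)
            (insert_subset hy hLB)).trans hC)
  have h0 : (∅ : Set ℝ) ⊆ A := empty_subset _
  refine ENNReal.iSup_add_iSup_le fun K L => ?_
  by_cases hKA : K ⊆ A
  · by_cases hLB : L ⊆ B
    · by_cases hK : IsCompact K
      · by_cases hL : IsCompact L
        · simpa [hKA, hLB, hK, hL] using key K hKA hK L hLB hL
        · simpa [hKA, hLB, hK, hL] using key K hKA hK ∅ (empty_subset _) isCompact_empty
      · by_cases hL : IsCompact L
        · simpa [hKA, hLB, hK, hL] using key ∅ (empty_subset _) isCompact_empty L hLB hL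
        · simp [hK, hL]
    · by_cases hK : IsCompact K
      · simpa [hKA, hLB, hK] using key K hKA hK ∅ (empty_subset _) isCompact_empty
      · simp [hK, hLB]
  · by_cases hLB : L ⊆ B
    · by_cases hL : IsCompact L
      · simpa [hKA, hLB, hL] using key ∅ (empty_subset _) isCompact_empty L hLB hL
      · simp [hKA, hL]
    · simp [hKA, hLB]

theorem lintegral_eq_lintegral_meas_lt_of_le_one {f : ℝ → ℝ≥0∞} (hf : Measurable f)
    (h1 : ∀ x, f x ≤ 1) :
    ∫⁻ x, f x = ∫⁻ τ in Ioo (0 : ℝ) 1, volume {x | ENNReal.ofReal τ < f x} := by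
  have hfin : ∀ x, f x ≠ ∞ := fun x => ((h1 x).trans_lt ENNReal.one_lt_top).ne
  have e := lintegral_eq_lintegral_meas_lt (volume : Measure ℝ) (f := fun x => (f x).toReal)
    (ae_of_all _ fun x => ENNReal.toReal_nonneg) hf.ennreal_toReal.aemeasurable
  simp only [ENNReal.ofReal_toReal (hfin _)] at e
  rw [e, ← Ioo_union_Ici_eq_Ioi (zero_lt_one' ℝ), lintegral_union measurableSet_Ici
    (by rw [Set.disjoint_left]; rintro x hx hx'; exact absurd hx.2 (not_lt.2 hx'))]
  have z : ∫⁻ t in Ici (1 : ℝ), volume {a | t < (f a).toReal} = 0 := by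
    rw [setLIntegral_congr_fun (g := fun _ => 0) measurableSet_Ici]
    · simp
    · intro t ht
      have : {a | t < (f a).toReal} = ∅ := by
        ext a
        simp only [mem_ofPred_eq, mem_empty_iff_false, iff_false, not_lt]
        exact (ENNReal.toReal_le_of_le_ofReal zero_le_one (by simpa using h1 a)).trans ht
      simp [this]
  rw [z, add_zero]
  refine setLIntegral_congr_fun measurableSet_Ioo fun t ht => ?_
  simp only [ENNReal.ofReal_lt_iff_lt_toReal ht.1.le (hfin _)]

theorem prekopa_leindler_of_iSup_eq_one {f g h : ℝ → ℝ≥0∞} (hf : Measurable f)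
    (hg : Measurable g) (hh : Measurable h) {s t : ℝ} (hs : 0 < s) (ht : 0 < t)
    (hst : s + t = 1) (hf1 : ⨆ x, f x = 1) (hg1 : ⨆ x, g x = 1)
    (H : ∀ x y, f x ^ s * g y ^ t ≤ h (s * x + t * y)) :
    (∫⁻ x, f x) ^ s * (∫⁻ x, g x) ^ t ≤ ∫⁻ x, h x := by
  have key : ENNReal.ofReal s * (∫⁻ x, f x) + ENNReal.ofReal t * (∫⁻ x, g x) ≤ ∫⁻ x, h x := by
    rw [lintegral_eq_lintegral_meas_lt_of_le_one hf (fun x => hf1 ▸ le_iSup f x),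
      lintegral_eq_lintegral_meas_lt_of_le_one hg (fun x => hg1 ▸ le_iSup g x)]
    refine le_trans ?_ (lintegral_mono (f := fun x => min (h x) 1) fun x => min_le_left _ _)
    rw [lintegral_eq_lintegral_meas_lt_of_le_one (hh.min measurable_const)
      fun x => min_le_right _ _]
    have mf : Measurable fun τ : ℝ => volume {x | ENNReal.ofReal τ < f x} :=
      Antitone.measurable fun a b hab => measure_mono fun x hx =>
        (ENNReal.ofReal_le_ofReal hab).trans_lt hx
    have mg : Measurable fun τ : ℝ => volume {x | ENNReal.ofReal τ < g x} :=
      Antitone.measurable fun a b hab => measure_mono fun x hx =>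
        (ENNReal.ofReal_le_ofReal hab).trans_lt hx
    rw [← lintegral_const_mul _ mf, ← lintegral_const_mul _ mg,
      ← lintegral_add_left (mf.const_mul _)]
    refine setLIntegral_mono' measurableSet_Ioo fun τ hτ => ?_
    have hτ1 : ENNReal.ofReal τ < 1 := by simpa using hτ.2
    have hτ0 : ENNReal.ofReal τ ≠ 0 := by simpa using hτ.1
    have es : ENNReal.ofReal s * volume {x | ENNReal.ofReal τ < f x} =
        volume (s • {x | ENNReal.ofReal τ < f x}) := by
      rw [Measure.addHaar_smul]; simp [abs_of_pos hs]
    have et : ENNReal.ofReal t * volume {x | ENNReal.ofReal τ < g x} =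
        volume (t • {x | ENNReal.ofReal τ < g x}) := by
      rw [Measure.addHaar_smul]; simp [abs_of_pos ht]
    rw [es, et]
    refine volume_add_le_of_add_subset ((measurableSet_lt measurable_const hf).const_smul₀ s)
      ((measurableSet_lt measurable_const hg).const_smul₀ t) ?_ ?_ ?_
    · obtain ⟨x, hx⟩ := lt_iSup_iff.1 (hf1 ▸ hτ1)
      exact ⟨s • x, smul_mem_smul_set hx⟩
    · obtain ⟨x, hx⟩ := lt_iSup_iff.1 (hg1 ▸ hτ1)
      exact ⟨t • x, smul_mem_smul_set hx⟩
    · rintro _ ⟨_, ⟨x, hx, rfl⟩, _, ⟨y, hy, rfl⟩, rfl⟩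
      simp only [smul_eq_mul, mem_ofPred_eq, lt_min_iff] at *
      refine ⟨lt_of_lt_of_le ?_ (H x y), hτ1⟩
      calc ENNReal.ofReal τ = ENNReal.ofReal τ ^ s * ENNReal.ofReal τ ^ t := by
            rw [← ENNReal.rpow_add _ _ hτ0 ENNReal.ofReal_ne_top, hst, ENNReal.rpow_one]
        _ < f x ^ s * g y ^ t :=
            ENNReal.mul_lt_mul (ENNReal.rpow_lt_rpow hx hs) (ENNReal.rpow_lt_rpow hy ht)
  refine le_trans ?_ key
  set F := ∫⁻ x, f x
  set G := ∫⁻ x, g x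
  by_cases hF : F = ∞
  · simp [hF, hs]
  by_cases hG : G = ∞
  · simp [hG, ht]
  have := Real.geom_mean_le_arith_mean2_weighted hs.le ht.le
    (ENNReal.toReal_nonneg (a := F)) (ENNReal.toReal_nonneg (a := G)) hst
  have := ENNReal.ofReal_le_ofReal this
  rw [ENNReal.ofReal_mul (by positivity), ENNReal.ofReal_add (by positivity) (by positivity),
    ENNReal.ofReal_mul hs.le, ENNReal.ofReal_mul ht.le,
    ← ENNReal.ofReal_rpow_of_nonneg (by positivity) hs.le,
    ← ENNReal.ofReal_rpow_of_nonneg (by positivity) ht.le] at this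
  simpa [ENNReal.ofReal_toReal hF, ENNReal.ofReal_toReal hG] using this

/-- The one-dimensional Prékopa-Leindler inequality. -/
theorem prekopa_leindler_real {f g h : ℝ → ℝ≥0∞} (hf : Measurable f)
    (hg : Measurable g) (hh : Measurable h) {s t : ℝ} (hs : 0 < s) (ht : 0 < t)
    (hst : s + t = 1) (H : ∀ x y, f x ^ s * g y ^ t ≤ h (s * x + t * y)) :
    (∫⁻ x, f x) ^ s * (∫⁻ x, g x) ^ t ≤ ∫⁻ x, h x := by
  have bdd : ∀ {f g : ℝ → ℝ≥0∞}, Measurable f → Measurable g → (⨆ x, f x) ≠ ∞ →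
      (⨆ x, g x) ≠ ∞ → (∀ x y, f x ^ s * g y ^ t ≤ h (s * x + t * y)) →
      (∫⁻ x, f x) ^ s * (∫⁻ x, g x) ^ t ≤ ∫⁻ x, h x := by
    intro f g hf hg hfs hgs H
    set a := ⨆ x, f x with ha
    set b := ⨆ x, g x with hb
    by_cases ha0 : a = 0
    · have : ∀ x, f x = 0 := fun x => le_antisymm (ha0 ▸ le_iSup f x) bot_le
      simp [this, hs]
    by_cases hb0 : b = 0
    · have : ∀ x, g x = 0 := fun x => le_antisymm (hb0 ▸ le_iSup g x) bot_le
      simp [this, ht]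
    set c := a ^ s * b ^ t with hc
    have hc0 : c ≠ 0 := mul_ne_zero (by simp [ha0, hfs]) (by simp [hb0, hgs])
    have hct : c ≠ ∞ := ENNReal.mul_ne_top (ENNReal.rpow_ne_top_of_nonneg hs.le hfs)
      (ENNReal.rpow_ne_top_of_nonneg ht.le hgs)
    have ci : c⁻¹ = (a⁻¹) ^ s * (b⁻¹) ^ t := by
      rw [hc, ENNReal.mul_inv (Or.inl (by simp [ha0, hfs]))
        (Or.inl (ENNReal.rpow_ne_top_of_nonneg hs.le hfs)), ENNReal.inv_rpow, ENNReal.inv_rpow]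
    have := prekopa_leindler_of_iSup_eq_one (f := fun x => a⁻¹ * f x) (g := fun x => b⁻¹ * g x)
      (h := fun x => c⁻¹ * h x) (hf.const_mul _) (hg.const_mul _) (hh.const_mul _) hs ht hst
      (by rw [← ENNReal.mul_iSup, ← ha, ENNReal.inv_mul_cancel ha0 hfs])
      (by rw [← ENNReal.mul_iSup, ← hb, ENNReal.inv_mul_cancel hb0 hgs])
      (fun x y => by
        rw [ENNReal.mul_rpow_of_nonneg _ _ hs.le, ENNReal.mul_rpow_of_nonneg _ _ ht.le,
          mul_mul_mul_comm, ← ci]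
        gcongr
        exact H x y)
    rw [lintegral_const_mul _ hf, lintegral_const_mul _ hg, lintegral_const_mul _ hh,
      ENNReal.mul_rpow_of_nonneg _ _ hs.le, ENNReal.mul_rpow_of_nonneg _ _ ht.le,
      mul_mul_mul_comm, ← ci] at this
    exact (ENNReal.mul_le_mul_iff_right (by simpa using hct) (by simpa using hc0)).1 this
  have trunc : ∀ {f : ℝ → ℝ≥0∞}, Measurable f →
      ∫⁻ x, f x = ⨆ N : ℕ, ∫⁻ x, min (f x) N := by
    intro f hf
    rw [← lintegral_iSup (fun N => hf.min measurable_const)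
      (fun i j hij x => min_le_min le_rfl (by exact_mod_cast hij))]
    congr with x
    rw [← inf_iSup_eq, ENNReal.iSup_natCast, inf_top_eq]
  have pow_iSup : ∀ (u : ℕ → ℝ≥0∞) {p : ℝ}, 0 < p → (⨆ i, u i) ^ p = ⨆ i, u i ^ p :=
    fun u p hp => (ENNReal.orderIsoRpow p hp).map_iSup u
  have supmin : ∀ (f : ℝ → ℝ≥0∞) (N : ℕ), ⨆ x, min (f x) (N : ℝ≥0∞) ≠ ∞ := fun f N =>
    ((iSup_le fun x => min_le_right _ _).trans_lt (ENNReal.natCast_lt_top N)).ne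
  rw [trunc hf, trunc hg, pow_iSup _ hs, pow_iSup _ ht, ENNReal.iSup_mul]
  refine iSup_le fun i => ?_
  rw [ENNReal.mul_iSup]
  refine iSup_le fun j => ?_
  refine bdd (hf.min measurable_const) (hg.min measurable_const) (supmin f i) (supmin g j) ?_
  intro x y
  refine le_trans ?_ (H x y)
  gcongr <;> exact min_le_left _ _

theorem measurable_insertNth {n : ℕ} (i : Fin (n + 1)) :
    Measurable fun p : ℝ × (Fin n → ℝ) => (i.insertNth p.1 p.2 : Fin (n + 1) → ℝ) := by
  refine measurable_pi_iff.2 fun j => ?_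
  refine i.succAboveCases ?_ (fun j => ?_) j
  · simpa using measurable_fst
  · simp only [Fin.insertNth_apply_succAbove]
    fun_prop

theorem lintegral_insertNth {n : ℕ} (i : Fin (n + 1)) {φ : (Fin (n + 1) → ℝ) → ℝ≥0∞}
    (hφ : Measurable φ) : ∫⁻ x, φ x = ∫⁻ a, ∫⁻ y, φ (i.insertNth a y) := by
  rw [← (volume_preserving_piFinSuccAbove (fun _ : Fin (n + 1) => ℝ) i).symm.lintegral_comp hφ,
    Measure.volume_eq_prod, lintegral_prod]
  · congr
  · exact (hφ.comp (MeasurableEquiv.measurable _)).aemeasurable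

/-- The Prékopa-Leindler inequality. -/
theorem prekopa_leindler {n : ℕ} {f g h : (Fin n → ℝ) → ℝ≥0∞} (hf : Measurable f)
    (hg : Measurable g) (hh : Measurable h) {s t : ℝ} (hs : 0 < s) (ht : 0 < t)
    (hst : s + t = 1) (H : ∀ x y, f x ^ s * g y ^ t ≤ h (s • x + t • y)) :
    (∫⁻ x, f x) ^ s * (∫⁻ x, g x) ^ t ≤ ∫⁻ x, h x := by
  induction n with
  | zero =>
    simp only [lintegral_unique]
    have e : (volume : Measure (Fin 0 → ℝ)) univ = 1 := by simp [volume_pi]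
    rw [e, mul_one, mul_one, mul_one]
    convert H default default
  | succ n ih =>
    have meas : ∀ {φ : (Fin (n + 1) → ℝ) → ℝ≥0∞}, Measurable φ →
        Measurable fun p : ℝ × (Fin n → ℝ) => φ ((0 : Fin (n + 1)).insertNth p.1 p.2) :=
      fun hφ => hφ.comp (measurable_insertNth 0)
    rw [lintegral_insertNth 0 hf, lintegral_insertNth 0 hg, lintegral_insertNth 0 hh]
    refine prekopa_leindler_real (meas hf).lintegral_prod_right' (meas hg).lintegral_prod_right'
      (meas hh).lintegral_prod_right' hs ht hst fun a b => ?_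
    refine ih ((meas hf).comp measurable_prodMk_left) ((meas hg).comp measurable_prodMk_left)
      ((meas hh).comp measurable_prodMk_left) fun x y => ?_
    refine (H _ _).trans_eq (congrArg h ?_)
    ext i
    refine Fin.cases ?_ (fun i => ?_) i <;> simp

theorem prod_erase_abs_sub {d i : ℕ} (hi : i ≤ d) :
    ∏ j ∈ (Finset.range (d + 1)).erase i, |(i : ℝ) - j| = i.factorial * (d - i).factorial := by
  have e : (Finset.range (d + 1)).erase i = Finset.range i ∪ Finset.Ico (i + 1) (d + 1) := by
    ext j; simp only [Finset.mem_erase, Finset.mem_range, Finset.mem_union, Finset.mem_Ico]; omega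
  have hd : Disjoint (Finset.range i) (Finset.Ico (i + 1) (d + 1)) := by
    rw [Finset.disjoint_left]; intro j; simp only [Finset.mem_range, Finset.mem_Ico]; omega
  rw [e, Finset.prod_union hd, Finset.prod_Ico_eq_prod_range, ← Finset.prod_range_reflect,
    ← Finset.prod_range_add_one_eq_factorial, ← Finset.prod_range_add_one_eq_factorial]
  push_cast
  congr 1
  · refine Finset.prod_congr rfl fun j hj => ?_
    have hj := Finset.mem_range.1 hj
    have : ((i - 1 - j : ℕ) : ℝ) = i - 1 - j := by
      rw [Nat.cast_sub (by omega), Nat.cast_sub (by omega)]; simp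
    rw [this, abs_of_nonneg (by linarith)]; ring
  · refine Finset.prod_congr (by congr 1) fun j hj => ?_
    rw [abs_of_nonpos (by linarith)]; ring

theorem sum_prod_erase_inv_abs_sub (d : ℕ) :
    ∑ i ∈ Finset.range (d + 1), ∏ j ∈ (Finset.range (d + 1)).erase i, |(i : ℝ) - j|⁻¹ =
      2 ^ d / d.factorial := by
  have h := Nat.sum_range_choose d
  rw [eq_div_iff (by positivity), Finset.sum_mul]
  have h' : ∑ i ∈ Finset.range (d + 1), (d.choose i : ℝ) = 2 ^ d := by exact_mod_cast h
  rw [← h']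
  refine Finset.sum_congr rfl fun i hi => ?_
  have hi : i ≤ d := by simpa [Nat.lt_succ_iff] using hi
  rw [Finset.prod_inv_distrib, prod_erase_abs_sub hi, Nat.cast_choose ℝ hi, inv_mul_eq_div]

theorem add_one_pow_div_factorial_le (d : ℕ) :
    ((d : ℝ) + 1) ^ d / d.factorial ≤ Real.exp 1 ^ d := by
  induction d with
  | zero => simp
  | succ d ih =>
    have h1 : ((d : ℝ) + 2) ^ (d + 1) ≤ Real.exp 1 * (d + 1) ^ (d + 1) := by
      have h : (d : ℝ) + 2 ≤ (d + 1) * Real.exp (1 / (d + 1)) := by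
        have := Real.add_one_le_exp (1 / ((d : ℝ) + 1))
        calc (d : ℝ) + 2 = (d + 1) * (1 / (d + 1) + 1) := by field_simp; ring
          _ ≤ _ := by gcongr
      calc ((d : ℝ) + 2) ^ (d + 1) ≤ ((d + 1) * Real.exp (1 / (d + 1))) ^ (d + 1) := by gcongr
        _ = Real.exp 1 * (d + 1) ^ (d + 1) := by
          rw [mul_pow, ← Real.exp_nat_mul, mul_comm]
          congr 2
          push_cast
          field_simp
    rw [div_le_iff₀ (by positivity)] at ih ⊢
    rw [Nat.factorial_succ]
    push_cast
    calc ((d : ℝ) + 1 + 1) ^ (d + 1) = ((d : ℝ) + 2) ^ (d + 1) := by ring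
      _ ≤ _ := h1
      _ = Real.exp 1 * (d + 1) * (d + 1) ^ d := by ring
      _ ≤ Real.exp 1 * (d + 1) * (Real.exp 1 ^ d * d.factorial) := by gcongr
      _ = _ := by ring

theorem exists_separated_points {S : Set ℝ} (hS : IsCompact S) (hm : 0 < volume.real S) (d : ℕ) :
    ∃ t : ℕ → ℝ, (∀ j ≤ d, t j ∈ S) ∧ ∀ j ≤ d, ∀ k ≤ d,
      volume.real S / (d + 1) * |(k : ℝ) - j| ≤ |t k - t j| := by
  set m := volume.real S with hmdef
  have hfin : ∀ t, volume (S ∩ Iic t) ≠ ⊤ := fun t =>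
    ((measure_mono inter_subset_left).trans_lt hS.measure_lt_top).ne
  set G : ℝ → ℝ := fun t => volume.real (S ∩ Iic t) with hG
  have hmono : Monotone G := fun a b hab =>
    measureReal_mono (inter_subset_inter_right _ (Iic_subset_Iic.2 hab)) (hfin b)
  have hlip' : ∀ a b, a ≤ b → G b - G a ≤ b - a := by
    intro a b hab
    have hsub : S ∩ Iic b ⊆ (S ∩ Iic a) ∪ Ioc a b := by
      rintro x ⟨hx, hxb⟩
      by_cases h : x ≤ a
      · exact Or.inl ⟨hx, h⟩
      · exact Or.inr ⟨not_le.1 h, hxb⟩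
    have h1 : G b ≤ volume.real ((S ∩ Iic a) ∪ Ioc a b) :=
      measureReal_mono hsub (measure_union_lt_top (hfin a).lt_top (by simp)).ne
    have h2 := measureReal_union_le (μ := volume) (S ∩ Iic a) (Ioc a b)
    rw [Real.volume_real_Ioc_of_le hab] at h2
    have h3 : volume.real (S ∩ Iic a) = G a := rfl
    linarith
  have hcont : Continuous G := by
    refine (LipschitzWith.of_le_add fun a b => ?_).continuous
    rcases le_total a b with h | h
    · have := hmono h
      have := dist_nonneg (x := a) (y := b)
      linarith
    · have := hlip' _ _ h
      rw [Real.dist_eq, abs_of_nonneg (by linarith)]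
      linarith
  have key : ∀ s, 0 < s → s ≤ m → ∃ t ∈ S, G t = s := by
    intro s hs hsm
    have hSne : S.Nonempty := nonempty_of_measureReal_ne_zero hm.ne'
    obtain ⟨M, hMS, hM⟩ := hS.exists_isGreatest hSne
    have hGM : G M = m := by
      change volume.real (S ∩ Iic M) = volume.real S
      rw [inter_eq_left.2 fun x hx => mem_Iic.2 (hM hx)]
    have hAc : IsCompact (S ∩ {t | s ≤ G t}) :=
      hS.inter_right (isClosed_le continuous_const hcont)
    obtain ⟨t₀, ⟨ht₀S, ht₀⟩, hmin⟩ := hAc.exists_isLeast ⟨M, hMS, by simpa [hGM] using hsm⟩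
    refine ⟨t₀, ht₀S, le_antisymm ?_ ht₀⟩
    by_contra! hlt
    have hev : ∀ᶠ t in nhdsWithin t₀ (Iio t₀), s < G t :=
      (hcont.continuousAt.eventually (lt_mem_nhds hlt)).filter_mono nhdsWithin_le_nhds
    obtain ⟨t₁, ht₁, ht₁'⟩ := (hev.and self_mem_nhdsWithin).exists
    have hne : (S ∩ Iic t₁).Nonempty :=
      nonempty_of_measureReal_ne_zero (μ := volume) (hs.trans ht₁).ne'
    obtain ⟨t₂, ⟨ht₂S, ht₂⟩, hmax⟩ := (hS.inter_right isClosed_Iic).exists_isGreatest hne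
    have : G t₂ = G t₁ := by
      simp only [hG]
      congr 1
      ext x
      exact ⟨fun h => ⟨h.1, mem_Iic.2 ((mem_Iic.1 h.2).trans (mem_Iic.1 ht₂))⟩, fun h => ⟨h.1, hmax h⟩⟩
    have := hmin ⟨ht₂S, by rw [mem_ofPred_eq, this]; exact ht₁.le⟩
    exact absurd (this.trans ht₂) (not_le.2 ht₁')
  have : ∀ j : ℕ, ∃ t, j ≤ d → t ∈ S ∧ G t = m / (d + 1) * (j + 1) := by
    intro j
    by_cases hj : j ≤ d
    · have hj' : (j : ℝ) ≤ d := by exact_mod_cast hj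
      obtain ⟨t, ht⟩ := key (m / (d + 1) * (j + 1)) (by positivity) (by
        rw [div_mul_eq_mul_div, div_le_iff₀ (by positivity)]
        gcongr)
      exact ⟨t, fun _ => ht⟩
    · exact ⟨0, fun h => absurd h hj⟩
  choose t ht using this
  refine ⟨t, fun j hj => (ht j hj).1, fun j hj k hk => ?_⟩
  have h : |G (t k) - G (t j)| ≤ |t k - t j| := by
    rcases le_total (t j) (t k) with h | h
    · rw [abs_of_nonneg (by linarith [hmono h]), abs_of_nonneg (by linarith)]
      exact hlip' _ _ h
    · rw [abs_sub_comm, abs_sub_comm (t k), abs_of_nonneg (by linarith [hmono h]),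
        abs_of_nonneg (by linarith)]
      exact hlip' _ _ h
  rw [(ht k hk).2, (ht j hj).2, ← mul_sub, abs_mul, abs_of_nonneg (by positivity)] at h
  simpa using h

/-- A Remez-type bound for the sublevel sets of a polynomial on an interval. -/
theorem Polynomial.volume_real_sublevel_le {p : Polynomial ℝ} {d : ℕ} (hd : 0 < d)
    (hp : p.natDegree ≤ d) {a b x ε c : ℝ} (hx : x ∈ Icc a b) (hε : 0 ≤ ε) (hc : 0 < c)
    (hpx : c ^ d ≤ |p.eval x|) :
    volume.real ({t | |p.eval t| ≤ ε ^ d} ∩ Icc a b) ≤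
      2 * Real.exp 1 * (ε / c) * (b - a) := by
  have hab : 0 ≤ b - a := by linarith [hx.1, hx.2]
  set S := {t | |p.eval t| ≤ ε ^ d} ∩ Icc a b
  have hS : IsCompact S := isCompact_Icc.inter_left (isClosed_le (by fun_prop) continuous_const)
  rcases (measureReal_nonneg (μ := volume) (s := S)).eq_or_lt with hm | hm
  · rw [← hm]; positivity
  obtain ⟨t, htS, ht⟩ := exists_separated_points hS hm d
  set m := volume.real S
  have hinj : Set.InjOn t (Finset.range (d + 1) : Finset ℕ) := by
    intro i hi j hj hij
    have hi : i ≤ d := by simpa [Nat.lt_succ_iff] using hi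
    have hj : j ≤ d := by simpa [Nat.lt_succ_iff] using hj
    have := ht i hi j hj
    rw [hij, sub_self, abs_zero] at this
    have h2 : |(j : ℝ) - i| ≤ 0 := by
      by_contra! h
      exact absurd this (not_le.2 (by positivity))
    have := abs_nonpos_iff.1 h2
    exact_mod_cast (sub_eq_zero.1 this).symm
  have hdeg : p.degree < (Finset.range (d + 1)).card := by
    rw [Finset.card_range]
    exact Polynomial.degree_le_natDegree.trans_lt (by exact_mod_cast Nat.lt_succ_of_le hp)
  have heval : p.eval x = ∑ i ∈ Finset.range (d + 1), p.eval (t i) *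
      ∏ j ∈ (Finset.range (d + 1)).erase i, (t i - t j)⁻¹ * (x - t j) := by
    conv_lhs => rw [Lagrange.eq_interpolate hinj hdeg]
    simp [Lagrange.interpolate_apply, Polynomial.eval_finsetSum, Lagrange.basis,
      Polynomial.eval_prod, Lagrange.basisDivisor]
  set R := (d + 1) * (b - a) / m with hR
  have hbound : |p.eval x| ≤ ε ^ d * (R ^ d * (2 ^ d / d.factorial)) := by
    rw [heval, ← sum_prod_erase_inv_abs_sub, Finset.mul_sum, Finset.mul_sum]
    refine (Finset.abs_sum_le_sum_abs _ _).trans (Finset.sum_le_sum fun i hi => ?_)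
    have hi' : i ≤ d := by simpa [Nat.lt_succ_iff] using hi
    rw [abs_mul, Finset.abs_prod]
    refine mul_le_mul (htS i hi').1 ?_ (Finset.prod_nonneg fun _ _ => abs_nonneg _)
      (by positivity)
    have hcard : ((Finset.range (d + 1)).erase i).card = d := by
      rw [Finset.card_erase_of_mem hi]; simp
    conv_rhs => rw [← hcard, ← Finset.prod_const, hcard, ← Finset.prod_mul_distrib]
    refine Finset.prod_le_prod (fun _ _ => abs_nonneg _) fun j hj => ?_
    have hj' : j ≤ d := by
      simpa [Nat.lt_succ_iff] using Finset.mem_of_mem_erase hj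
    have hne : (i : ℝ) - j ≠ 0 := sub_ne_zero.2 (by exact_mod_cast (Finset.ne_of_mem_erase hj).symm)
    have hpos : 0 < |(i : ℝ) - j| := abs_pos.2 hne
    have h1 : |x - t j| ≤ b - a := by
      have := (htS j hj').2
      rw [abs_le]; constructor <;> linarith [this.1, this.2, hx.1, hx.2]
    have h2 := ht j hj' i hi'
    rw [abs_mul, abs_inv]
    calc |t i - t j|⁻¹ * |x - t j| ≤ (m / (d + 1) * |(i : ℝ) - j|)⁻¹ * (b - a) := by
          gcongr
      _ = R * |(i : ℝ) - j|⁻¹ := by rw [hR]; field_simp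
  have hfin : c ^ d ≤ (2 * Real.exp 1 * ε * (b - a) / m) ^ d := by
    calc c ^ d ≤ _ := hpx
      _ ≤ _ := hbound
      _ = (2 * ε * (b - a) / m) ^ d * (((d : ℝ) + 1) ^ d / d.factorial) := by
        rw [hR]; field_simp; simp only [mul_pow, div_pow]; ring
      _ ≤ (2 * ε * (b - a) / m) ^ d * Real.exp 1 ^ d := by
        gcongr; exact add_one_pow_div_factorial_le d
      _ = _ := by rw [← mul_pow]; congr 1; ring
  have := (pow_le_pow_iff_left₀ hc.le (by positivity) hd.ne').1 hfin
  rw [le_div_iff₀ hm] at this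
  calc m = c * m / c := by field_simp
    _ ≤ (2 * Real.exp 1 * ε * (b - a)) / c := by gcongr
    _ = _ := by ring

theorem volume_inter_le_of_ordConnected {E S : Set ℝ} {b δ : ℝ} (hδ : 0 < δ)
    (hE : ∀ x ≤ b, ∀ y ≥ b, volume (E ∩ Icc x y) ≤ ENNReal.ofReal (δ * (y - x)))
    (hS : S.OrdConnected) (hb : b ∈ S) :
    volume (E ∩ S) ≤ ENNReal.ofReal δ * volume S := by
  by_cases hfin : volume S = ∞
  · rw [hfin, ENNReal.mul_top (by simpa using hδ)]; exact le_top
  have hab : BddAbove S := by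
    by_contra h
    refine hfin (top_le_iff.1 ?_)
    rw [← Real.volume_Ici (a := b)]
    refine measure_mono fun x hx => ?_
    obtain ⟨y, hy, hxy⟩ := not_bddAbove_iff.1 h x
    exact hS.out hb hy ⟨hx, hxy.le⟩
  have hbe : BddBelow S := by
    by_contra h
    refine hfin (top_le_iff.1 ?_)
    rw [← Real.volume_Iic (a := b)]
    refine measure_mono fun x hx => ?_
    obtain ⟨y, hy, hxy⟩ := not_bddBelow_iff.1 h x
    exact hS.out hy hb ⟨hxy.le, hx⟩
  have h1 : S ⊆ Icc (sInf S) (sSup S) := subset_Icc_csInf_csSup hbe hab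
  have h2 : Ioo (sInf S) (sSup S) ⊆ S := by
    rintro x ⟨hx, hx'⟩
    obtain ⟨y, hy, hyx⟩ := exists_lt_of_csInf_lt ⟨b, hb⟩ hx
    obtain ⟨z, hz, hxz⟩ := exists_lt_of_lt_csSup ⟨b, hb⟩ hx'
    exact hS.out hy hz ⟨hyx.le, hxz.le⟩
  calc volume (E ∩ S) ≤ volume (E ∩ Icc (sInf S) (sSup S)) :=
        measure_mono (inter_subset_inter_right _ h1)
    _ ≤ ENNReal.ofReal (δ * (sSup S - sInf S)) := hE _ (h1 hb).1 _ (h1 hb).2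
    _ = ENNReal.ofReal δ * volume (Ioo (sInf S) (sSup S)) := by
      rw [Real.volume_Ioo, ENNReal.ofReal_mul hδ.le]
    _ ≤ _ := by gcongr

theorem setIntegral_le_of_unimodal {g : ℝ → ℝ} {E : Set ℝ} {b δ : ℝ} (hδ : 0 < δ)
    (hE : ∀ x ≤ b, ∀ y ≥ b, volume (E ∩ Icc x y) ≤ ENNReal.ofReal (δ * (y - x)))
    (hg : Measurable g) (hgi : Integrable g) (hg0 : ∀ x, 0 ≤ g x)
    (hmono : MonotoneOn g (Iic b)) (hanti : AntitoneOn g (Ici b)) :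
    ∫ x in E, g x ≤ δ * ∫ x, g x := by
  have key : ∫⁻ x in E, ENNReal.ofReal (g x) ≤
      ENNReal.ofReal δ * ∫⁻ x, ENNReal.ofReal (g x) := by
    rw [lintegral_eq_lintegral_meas_lt _ (ae_of_all _ hg0) hg.aemeasurable,
      lintegral_eq_lintegral_meas_lt _ (ae_of_all _ hg0) hg.aemeasurable,
      ← lintegral_const_mul' _ _ ENNReal.ofReal_ne_top]
    refine lintegral_mono fun t => ?_
    rw [Measure.restrict_apply (measurableSet_lt measurable_const hg), inter_comm]
    by_cases ht : t < g b
    · refine volume_inter_le_of_ordConnected hδ hE ⟨?_⟩ ht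
      rintro x hx y hy z ⟨hxz, hzy⟩
      rcases le_total z b with h | h
      · exact lt_of_lt_of_le hx (hmono (hxz.trans h) h hxz)
      · exact lt_of_lt_of_le hy (hanti h (h.trans hzy) hzy)
    · have : {a | t < g a} = ∅ := by
        refine eq_empty_of_forall_notMem fun x hx => ht (lt_of_lt_of_le hx ?_)
        rcases le_total x b with h | h
        · exact hmono h (mem_Iic.2 le_rfl) h
        · exact hanti (mem_Ici.2 le_rfl) h h
      simp [this]
  rw [← ofReal_integral_eq_lintegral_ofReal hgi.integrableOn (ae_of_all _ hg0),
    ← ofReal_integral_eq_lintegral_ofReal hgi (ae_of_all _ hg0),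
    ← ENNReal.ofReal_mul hδ.le] at key
  exact (ENNReal.ofReal_le_ofReal_iff (mul_nonneg hδ.le (integral_nonneg hg0))).1 key

/-- A nonnegative function is log-concave if it satisfies the multiplicative form of concavity. -/
def IsLogConcave (f : ℝ → ℝ) : Prop :=
  ∀ s t : ℝ, 0 < s → 0 < t → s + t = 1 → ∀ x y, f x ^ s * f y ^ t ≤ f (s * x + t * y)

theorem IsLogConcave.antitoneOn {f : ℝ → ℝ} (hf : IsLogConcave f) (h0 : ∀ x, 0 ≤ f x) {m : ℝ}
    (hm : ∀ x, f x ≤ f m) : AntitoneOn f (Ici m) := by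
  intro x hx y hy hxy
  rcases (mem_Ici.1 hx).eq_or_lt with rfl | hx
  · exact hm y
  rcases hxy.eq_or_lt with rfl | hxy
  · exact le_rfl
  rcases (h0 y).eq_or_lt with h | h
  · rw [← h]; exact h0 x
  have hym : 0 < y - m := by linarith
  have := hf ((y - x) / (y - m)) ((x - m) / (y - m)) (div_pos (by linarith) hym)
    (div_pos (by linarith) hym) (by field_simp; ring) m y
  rw [show (y - x) / (y - m) * m + (x - m) / (y - m) * y = x by field_simp; ring] at this
  refine le_trans ?_ this
  calc f y = f y ^ ((y - x) / (y - m)) * f y ^ ((x - m) / (y - m)) := by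
        rw [← Real.rpow_add h, show (y - x) / (y - m) + (x - m) / (y - m) = 1 by field_simp; ring,
          Real.rpow_one]
    _ ≤ _ := by
        have := div_nonneg (sub_nonneg.2 hxy.le) hym.le
        have := hm y
        have := h0 m
        gcongr

theorem IsLogConcave.comp_neg {f : ℝ → ℝ} (hf : IsLogConcave f) :
    IsLogConcave fun x => f (-x) := by
  intro s t hs ht hst x y
  have := hf s t hs ht hst (-x) (-y)
  rwa [show s * -x + t * -y = -(s * x + t * y) by ring] at this

theorem IsLogConcave.monotoneOn {f : ℝ → ℝ} (hf : IsLogConcave f) (h0 : ∀ x, 0 ≤ f x) {m : ℝ}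
    (hm : ∀ x, f x ≤ f m) : MonotoneOn f (Iic m) := by
  intro x hx y hy hxy
  have := hf.comp_neg.antitoneOn (fun x => h0 (-x)) (m := -m) (by simpa using fun x => hm (-x))
    (neg_le_neg (mem_Iic.1 hy)) (neg_le_neg (mem_Iic.1 hx)) (neg_le_neg hxy)
  simpa using this

theorem IsLogConcave.rpow_mul_rpow_integral_Ici_le {f : ℝ → ℝ} (hf : IsLogConcave f)
    (hfm : Measurable f) (hfi : Integrable f) (h0 : ∀ x, 0 ≤ f x) {s t : ℝ} (hs : 0 < s)
    (ht : 0 < t) (hst : s + t = 1) (a b : ℝ) :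
    (∫ x in Ici a, f x) ^ s * (∫ x in Ici b, f x) ^ t ≤ ∫ x in Ici (s * a + t * b), f x := by
  have hmeas : ∀ c : ℝ, Measurable ((Ici c).indicator fun x => ENNReal.ofReal (f x)) :=
    fun c => hfm.ennreal_ofReal.indicator measurableSet_Ici
  have key := prekopa_leindler_real (hmeas a) (hmeas b) (hmeas (s * a + t * b)) hs ht hst (by
    intro x y
    by_cases hx : x ∈ Ici a
    · by_cases hy : y ∈ Ici b
      · have : s * x + t * y ∈ Ici (s * a + t * b) := by
          have := mem_Ici.1 hx
          have := mem_Ici.1 hy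
          exact mem_Ici.2 (by gcongr)
        rw [indicator_of_mem hx, indicator_of_mem hy, indicator_of_mem this,
          ENNReal.ofReal_rpow_of_nonneg (h0 _) hs.le, ENNReal.ofReal_rpow_of_nonneg (h0 _) ht.le,
          ← ENNReal.ofReal_mul (Real.rpow_nonneg (h0 _) _)]
        exact ENNReal.ofReal_le_ofReal (hf s t hs ht hst x y)
      · simp [indicator_of_notMem hy, ht]
    · simp [indicator_of_notMem hx, hs])
  have e : ∀ c : ℝ, ∫⁻ x, (Ici c).indicator (fun x => ENNReal.ofReal (f x)) x =
      ENNReal.ofReal (∫ x in Ici c, f x) := fun c => by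
    rw [lintegral_indicator measurableSet_Ici,
      ofReal_integral_eq_lintegral_ofReal hfi.integrableOn (ae_of_all _ h0)]
  have hn : ∀ c : ℝ, 0 ≤ ∫ x in Ici c, f x := fun c => integral_nonneg h0
  rw [e, e, e, ENNReal.ofReal_rpow_of_nonneg (hn _) hs.le,
    ENNReal.ofReal_rpow_of_nonneg (hn _) ht.le,
    ← ENNReal.ofReal_mul (Real.rpow_nonneg (hn _) _)] at key
  exact (ENNReal.ofReal_le_ofReal_iff (hn _)).1 key

theorem IsLogConcave.sub_mul_le {f : ℝ → ℝ} (hf : IsLogConcave f)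
    (hfm : Measurable f) (hfi : Integrable f) (h0 : ∀ x, 0 ≤ f x) {m b : ℝ}
    (hm : ∀ x, f x ≤ f m) (hmb : m ≤ b) (hb : 0 < ∫ x in Ici b, f x) :
    (b - m) * f m ≤ (∫ x in Ici m, f x) *
      Real.log ((∫ x in Ici m, f x) / ∫ x in Ici b, f x) := by
  have hanti := hf.antitoneOn h0 hm
  have hfb : 0 < f b := by
    refine (h0 b).lt_of_ne fun h => hb.ne' ?_
    rw [← integral_zero ℝ ℝ, ← integral_indicator measurableSet_Ici]
    congr 1
    ext x
    refine indicator_apply_eq_zero.2 fun hx => le_antisymm ?_ (h0 x)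
    rw [h]
    exact hanti hmb (hmb.trans hx) hx
  have hfm0 : 0 < f m := hfb.trans_le (hm b)
  have hle : ∫ x in Ici b, f x ≤ ∫ x in Ici m, f x :=
    setIntegral_mono_set hfi.integrableOn (ae_of_all _ h0) (Ici_subset_Ici.2 hmb).eventuallyLE
  set A := ∫ x in Ici m, f x with hA
  set B := ∫ x in Ici b, f x with hB
  have hA0 : 0 < A := hb.trans_le hle
  have step : ∀ t ∈ Ioo (0 : ℝ) 1, (b - m) * (f m ^ (1 - t) * f b ^ t) ≤ A * Real.log (A / B) := by
    rintro t ⟨ht0, ht1⟩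
    set z := (1 - t) * m + t * b with hz
    have hmz : m ≤ z := by rw [hz]; nlinarith
    have h1 := hf.rpow_mul_rpow_integral_Ici_le hfm hfi h0 (sub_pos.2 ht1) ht0 (by ring) m b
    have h2 : f m ^ (1 - t) * f b ^ t ≤ f z := hf _ _ (sub_pos.2 ht1) ht0 (by ring) m b
    have h3 : (z - m) * f z ≤ A - ∫ x in Ici z, f x := by
      have e : A = (∫ x in Ico m z, f x) + ∫ x in Ici z, f x := by
        rw [hA, ← Ico_union_Ici_eq_Ici hmz]
        exact setIntegral_union (disjoint_left.2 fun x hx hx' => absurd hx.2 (not_lt.2 hx'))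
          measurableSet_Ici hfi.integrableOn hfi.integrableOn
      have : ∫ x in Ico m z, f z ≤ ∫ x in Ico m z, f x :=
        setIntegral_mono_on (by simp [integrableOn_const_iff]) hfi.integrableOn measurableSet_Ico
          fun x hx => hanti hx.1 hmz hx.2.le
      rw [setIntegral_const, Real.volume_real_Ico_of_le hmz, smul_eq_mul] at this
      linarith
    have h4 : A ^ (1 - t) * B ^ t = A * Real.exp (-(t * Real.log (A / B))) := by
      rw [Real.log_div hA0.ne' hb.ne', Real.rpow_def_of_pos hA0, Real.rpow_def_of_pos hb,
        ← Real.exp_add]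
      conv_rhs => rw [← Real.exp_log hA0, Real.log_exp, ← Real.exp_add]
      congr 1; ring
    have h5 := Real.add_one_le_exp (-(t * Real.log (A / B)))
    have h6 : (z - m) * f z ≤ A * (t * Real.log (A / B)) := by
      have := mul_le_mul_of_nonneg_left h5 hA0.le
      rw [← h4] at this
      have : A ^ (1 - t) * B ^ t ≤ ∫ x in Ici z, f x := h1
      nlinarith
    have h7 : t * ((b - m) * f z) ≤ t * (A * Real.log (A / B)) := by
      calc t * ((b - m) * f z) = (z - m) * f z := by rw [hz]; ring
        _ ≤ _ := h6
        _ = _ := by ring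
    exact (mul_le_mul_of_nonneg_left h2 (by linarith)).trans (le_of_mul_le_mul_left h7 ht0)
  have hcont : Continuous fun t : ℝ => (b - m) * (f m ^ (1 - t) * f b ^ t) := by
    refine continuous_const.mul (Continuous.mul ?_ ?_)
    · exact continuous_const.rpow (by fun_prop) fun _ => Or.inl hfm0.ne'
    · exact continuous_const.rpow continuous_id fun _ => Or.inl hfb.ne'
  have hlim := (hcont.tendsto 0).mono_left (nhdsWithin_le_nhds (s := Ioi 0))
  simp only [sub_zero, Real.rpow_one, Real.rpow_zero, mul_one] at hlim
  refine le_of_tendsto hlim ?_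
  filter_upwards [Ioo_mem_nhdsGT (zero_lt_one' ℝ)] with t ht using step t ht

theorem IsLogConcave.setIntegral_le_of_Ici {f : ℝ → ℝ} (hf : IsLogConcave f)
    (hfm : Measurable f) (hfi : Integrable f) (h0 : ∀ x, 0 ≤ f x) {m : ℝ}
    (hm : ∀ x, f x ≤ f m) {U E : Set ℝ} (hU : IsClosed U) {δ u : ℝ}
    (hδ : 0 < δ) (hu : 0 < u) (hpos : 0 < ∫ x in Ici m, f x)
    (hUu : u * ∫ x in Ici m, f x ≤ ∫ x in U ∩ Ici m, f x)
    (hE : ∀ b ∈ U, ∀ x ≤ b, ∀ y ≥ b, volume (E ∩ Icc x y) ≤ ENNReal.ofReal (δ * (y - x))) :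
    ∫ x in E, f x ≤ δ * (1 + Real.log (1 / u)) * ∫ x, f x := by
  have hne : (U ∩ Ici m).Nonempty := by
    by_contra h
    rw [not_nonempty_iff_eq_empty] at h
    rw [h, setIntegral_empty] at hUu
    exact absurd hUu (not_le.2 (mul_pos hu hpos))
  have hbdd : BddBelow (U ∩ Ici m) := ⟨m, fun x hx => hx.2⟩
  set b := sInf (U ∩ Ici m)
  have hb : b ∈ U ∩ Ici m := (hU.inter isClosed_Ici).csInf_mem hne hbdd
  have hmb : m ≤ b := hb.2
  have hle : ∫ x in U ∩ Ici m, f x ≤ ∫ x in Ici b, f x :=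
    setIntegral_mono_set hfi.integrableOn (ae_of_all _ h0)
      (LE.le.eventuallyLE fun x hx => csInf_le hbdd hx)
  have hB : 0 < ∫ x in Ici b, f x := (mul_pos hu hpos).trans_le (hUu.trans hle)
  have h1 := hf.sub_mul_le hfm hfi h0 hm hmb hB
  have hlog : Real.log ((∫ x in Ici m, f x) / ∫ x in Ici b, f x) ≤ Real.log (1 / u) := by
    refine Real.log_le_log (div_pos hpos hB) ?_
    rw [div_le_div_iff₀ hB hu]
    linarith
  have hbb : ∫ x in Ici b, f x ≤ ∫ x in Ici m, f x :=
    setIntegral_mono_set hfi.integrableOn (ae_of_all _ h0) (Ici_subset_Ici.2 hmb).eventuallyLE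
  have hlog0 : 0 ≤ Real.log (1 / u) :=
    (Real.log_nonneg ((one_le_div hB).2 hbb)).trans hlog
  have hAT : ∫ x in Ici m, f x ≤ ∫ x, f x := setIntegral_le_integral hfi (ae_of_all _ h0)
  set k : ℝ → ℝ := (Icc m b).indicator fun _ => f m with hk
  have hkm : Measurable k := measurable_const.indicator measurableSet_Icc
  have hki : Integrable k := by
    rw [hk, integrable_indicator_iff measurableSet_Icc]; simp [integrableOn_const_iff]
  have hk0 : ∀ x, 0 ≤ k x := fun x => indicator_nonneg (fun _ _ => h0 m) x
  have hkle : ∀ x, k x ≤ f m := fun x => indicator_le_self' (fun _ _ => h0 m) x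
  have hanti := hf.antitoneOn h0 hm
  have hmono := hf.monotoneOn h0 hm
  have hgi : Integrable fun x => max (f x) (k x) := hfi.sup hki
  have main := setIntegral_le_of_unimodal (g := fun x => max (f x) (k x)) hδ (hE b hb.1)
    (hfm.max hkm) hgi (fun x => le_max_of_le_left (h0 x)) (by
      intro x hx y hy hxy
      rcases lt_or_ge y m with h | h
      · refine max_le (le_max_of_le_left (hmono (hxy.trans h.le) h.le hxy)) ?_
        have : k x = 0 := indicator_of_notMem (fun h' => absurd h'.1 (not_le.2 (hxy.trans_lt h))) _
        rw [this]
        exact le_max_of_le_left (h0 y)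
      · have : k y = f m := indicator_of_mem (show y ∈ Icc m b from ⟨h, hy⟩) _
        refine le_max_of_le_right ?_
        rw [this]
        exact max_le (hm x) (hkle x)) (by
      intro x hx y hy hxy
      refine max_le (le_max_of_le_left (hanti (hmb.trans hx) (hmb.trans hy) hxy)) ?_
      by_cases hyb : y = b
      · have : x = y := le_antisymm hxy (hyb ▸ hx)
        rw [this]; exact le_max_right _ _
      · have : k y = 0 := indicator_of_notMem
          (fun h' => hyb (le_antisymm h'.2 hy)) _
        rw [this]
        exact le_max_of_le_left (h0 x))
  calc ∫ x in E, f x ≤ ∫ x in E, max (f x) (k x) :=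
        integral_mono hfi.integrableOn hgi.integrableOn fun x => le_max_left _ _
    _ ≤ δ * ∫ x, max (f x) (k x) := main
    _ ≤ δ * ((∫ x, f x) + ∫ x, k x) := by
        rw [← integral_add hfi hki]
        refine mul_le_mul_of_nonneg_left (integral_mono hgi (hfi.add hki) fun x => ?_) hδ.le
        exact max_le_add_of_nonneg (h0 x) (hk0 x)
    _ = δ * ((∫ x, f x) + (b - m) * f m) := by
        rw [hk, integral_indicator measurableSet_Icc, setIntegral_const,
          Real.volume_real_Icc_of_le hmb, smul_eq_mul]
    _ ≤ δ * ((∫ x, f x) + (∫ x, f x) * Real.log (1 / u)) := by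
        refine mul_le_mul_of_nonneg_left (add_le_add_right ?_ _) hδ.le
        exact h1.trans (mul_le_mul hAT hlog
          (Real.log_nonneg ((one_le_div hB).2 hbb)) (integral_nonneg h0))
    _ = _ := by ring

theorem setIntegral_neg_comp_neg (f : ℝ → ℝ) (S : Set ℝ) :
    ∫ x in -S, f (-x) = ∫ x in S, f x :=
  (Measure.measurePreserving_neg volume).setIntegral_preimage_emb
    (MeasurableEquiv.neg ℝ).measurableEmbedding f S

/-- A Remez-type estimate for a log-concave density on the line. -/
theorem IsLogConcave.setIntegral_le {f : ℝ → ℝ} (hf : IsLogConcave f)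
    (hfm : Measurable f) (hfi : Integrable f) (h0 : ∀ x, 0 ≤ f x) {m : ℝ}
    (hm : ∀ x, f x ≤ f m) {U E : Set ℝ} (hU : IsClosed U) {δ u : ℝ}
    (hδ : 0 < δ) (hu : 0 < u) (hpos : 0 < ∫ x, f x)
    (hUu : u * ∫ x, f x ≤ ∫ x in U, f x)
    (hE : ∀ b ∈ U, ∀ x ≤ b, ∀ y ≥ b, volume (E ∩ Icc x y) ≤ ENNReal.ofReal (δ * (y - x))) :
    ∫ x in E, f x ≤ δ * (1 + Real.log (1 / u)) * ∫ x, f x := by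
  by_cases hR : 0 < ∫ x in Ici m, f x ∧ u * ∫ x in Ici m, f x ≤ ∫ x in U ∩ Ici m, f x
  · exact hf.setIntegral_le_of_Ici hfm hfi h0 hm hU hδ hu hR.1 hR.2 hE
  have hset : ∀ S : Set ℝ, 0 ≤ ∫ x in S, f x := fun S => integral_nonneg h0
  have hsub : ∀ {S S' : Set ℝ}, S ⊆ S' → ∫ x in S, f x ≤ ∫ x in S', f x := fun h =>
    setIntegral_mono_set hfi.integrableOn (ae_of_all _ h0) h.eventuallyLE
  have hTot : ∫ x, f x = (∫ x in Iic m, f x) + ∫ x in Ici m, f x := by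
    rw [integral_Ici_eq_integral_Ioi, ← setIntegral_union (Iic_disjoint_Ioi le_rfl)
      measurableSet_Ioi hfi.integrableOn hfi.integrableOn, Iic_union_Ioi, setIntegral_univ]
  have hUle : ∫ x in U, f x ≤ (∫ x in U ∩ Iic m, f x) + ∫ x in U ∩ Ici m, f x := by
    rw [← integral_inter_add_sdiff measurableSet_Iic hfi.integrableOn (s := U) (t := Iic m)]
    gcongr ?_ + ?_
    · exact le_rfl
    · exact hsub fun x hx => ⟨hx.1, (not_le.1 fun h => hx.2 (mem_Iic.2 h)).le⟩
  have hL : 0 < ∫ x in Iic m, f x ∧ u * ∫ x in Iic m, f x ≤ ∫ x in U ∩ Iic m, f x := by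
    have hUR : ∫ x in U ∩ Ici m, f x ≤ ∫ x in Ici m, f x := hsub inter_subset_right
    have hUL : ∫ x in U ∩ Iic m, f x ≤ ∫ x in Iic m, f x := hsub inter_subset_right
    have h3 := hset (Ici m)
    have h4 := hset (Iic m)
    rcases h3.eq_or_lt with h | h
    · rw [← h] at hUR hTot
      rw [hTot] at hpos hUu
      constructor <;> linarith
    · have h5 : ∫ x in U ∩ Ici m, f x < u * ∫ x in Ici m, f x := by
        by_contra! h6; exact hR ⟨h, h6⟩
      rw [hTot, mul_add] at hUu
      have h6 : u * ∫ x in Iic m, f x < ∫ x in U ∩ Iic m, f x := by linarith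
      exact ⟨((mul_nonneg hu.le h4).trans_lt h6).trans_le hUL, h6.le⟩
  have := hf.comp_neg.setIntegral_le_of_Ici (hfm.comp measurable_neg) hfi.comp_neg
    (fun x => h0 _) (m := -m) (by simpa using fun x => hm (-x)) (U := -U) (E := -E)
    hU.neg hδ hu (by rw [← Set.neg_Iic, setIntegral_neg_comp_neg]; exact hL.1)
    (by rw [← Set.neg_Iic, ← Set.inter_neg, setIntegral_neg_comp_neg, setIntegral_neg_comp_neg]
        exact hL.2)
    (by
      intro b hb x hx y hy
      have h := hE (-b) hb (-y) (neg_le_neg hy) (-x) (neg_le_neg hx)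
      have e : -E ∩ Icc x y = -(E ∩ Icc (-y) (-x)) := by
        rw [Set.inter_neg, Set.neg_Icc, neg_neg, neg_neg]
      rw [e, Measure.measure_neg]
      rwa [show -x - -y = y - x by ring] at h)
  rwa [setIntegral_neg_comp_neg, integral_neg_eq_self f] at this

/-- The slice of a set in `ℝⁿ⁺¹` at height `t` in the `i`-th coordinate. -/
def coordSlice {n : ℕ} (i : Fin (n + 1)) (K : Set (Fin (n + 1) → ℝ)) (t : ℝ) : Set (Fin n → ℝ) :=
  {y | i.insertNth t y ∈ K}

theorem measurableSet_coordSlice {n : ℕ} (i : Fin (n + 1)) {K : Set (Fin (n + 1) → ℝ)}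
    (hK : MeasurableSet K) (t : ℝ) : MeasurableSet (coordSlice i K t) :=
  ((measurable_insertNth i).comp measurable_prodMk_left) hK

theorem measurable_volume_coordSlice {n : ℕ} (i : Fin (n + 1)) {K : Set (Fin (n + 1) → ℝ)}
    (hK : MeasurableSet K) : Measurable fun t => volume (coordSlice i K t) :=
  measurable_measure_prodMk_left ((measurable_insertNth i) hK)

theorem setLIntegral_volume_coordSlice {n : ℕ} (i : Fin (n + 1)) {K : Set (Fin (n + 1) → ℝ)}
    (hK : MeasurableSet K) {S : Set ℝ} (hS : MeasurableSet S) :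
    ∫⁻ t in S, volume (coordSlice i K t) = volume (K ∩ {x | x i ∈ S}) := by
  have hm : MeasurableSet (K ∩ {x | x i ∈ S}) := hK.inter (measurable_pi_apply i hS)
  rw [← lintegral_indicator_one hm, lintegral_insertNth i (measurable_one.indicator hm),
    ← lintegral_indicator hS]
  congr 1
  ext t
  by_cases ht : t ∈ S
  · rw [indicator_of_mem ht, ← lintegral_indicator_one (measurableSet_coordSlice i hK t)]
    congr 1
    ext y
    have : y ∈ coordSlice i K t ↔ (i.insertNth t y : Fin (n + 1) → ℝ) ∈ K ∩ {x | x i ∈ S} :=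
      ⟨fun h => ⟨h, by simpa using ht⟩, fun h => h.1⟩
    by_cases h : y ∈ coordSlice i K t
    · rw [indicator_of_mem h, indicator_of_mem (this.1 h)]; rfl
    · rw [indicator_of_notMem h, indicator_of_notMem fun h' => h (this.2 h')]
  · rw [indicator_of_notMem ht]
    simp [indicator, ht]

theorem volume_coordSlice_ne_top {n : ℕ} (i : Fin (n + 1)) {K : Set (Fin (n + 1) → ℝ)}
    (hK : IsCompact K) (t : ℝ) : volume (coordSlice i K t) ≠ ∞ := by
  have hc : IsCompact ((fun (x : Fin (n + 1) → ℝ) j => x (i.succAbove j)) '' K) :=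
    hK.image (by fun_prop)
  refine ((measure_mono fun y hy => ?_).trans_lt hc.measure_lt_top).ne
  exact ⟨_, hy, by ext j; simp⟩

theorem upperSemicontinuous_volume_coordSlice {n : ℕ} (i : Fin (n + 1))
    {K : Set (Fin (n + 1) → ℝ)} (hK : IsCompact K) :
    UpperSemicontinuous fun t => volume (coordSlice i K t) := by
  intro t c hc
  obtain ⟨O, hO, hOo, hOc⟩ := Set.exists_isOpen_lt_of_lt _ c hc
  have hrem : Continuous fun (x : Fin (n + 1) → ℝ) j => x (i.succAbove j) := by fun_prop
  have hA : IsCompact (K ∩ {x | (fun j => x (i.succAbove j)) ∉ O}) :=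
    hK.inter_right (hOo.isClosed_compl.preimage hrem)
  have hP : IsClosed ((fun x : Fin (n + 1) → ℝ => x i) '' (K ∩ {x | (fun j => x (i.succAbove j)) ∉ O})) :=
    (hA.image (continuous_apply i)).isClosed
  have ht : t ∉ (fun x : Fin (n + 1) → ℝ => x i) '' (K ∩ {x | (fun j => x (i.succAbove j)) ∉ O}) := by
    rintro ⟨x, ⟨hxK, hxO⟩, rfl⟩
    refine hxO (hO ?_)
    change i.insertNth (x i) (i.removeNth x) ∈ K
    rwa [Fin.insertNth_self_removeNth]
  filter_upwards [hP.isOpen_compl.mem_nhds ht] with t' ht'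
  refine (measure_mono fun y hy => ?_).trans_lt hOc
  by_contra hyO
  exact ht' ⟨_, ⟨hy, by simpa using hyO⟩, by simp⟩

theorem exists_forall_volume_coordSlice_le {n : ℕ} (i : Fin (n + 1))
    {K : Set (Fin (n + 1) → ℝ)} (hK : IsCompact K) (hne : K.Nonempty) :
    ∃ m, ∀ t, volume (coordSlice i K t) ≤ volume (coordSlice i K m) := by
  obtain ⟨m, -, hm⟩ := (upperSemicontinuous_volume_coordSlice i hK).upperSemicontinuousOn
    ((fun x : Fin (n + 1) → ℝ => x i) '' K) |>.exists_isMaxOn (hne.image _)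
    (hK.image (continuous_apply i))
  refine ⟨m, fun t => ?_⟩
  by_cases ht : t ∈ (fun x : Fin (n + 1) → ℝ => x i) '' K
  · exact hm ht
  · have : coordSlice i K t = ∅ :=
      eq_empty_of_forall_notMem fun y hy => ht ⟨_, hy, by simp⟩
    simp [this]

theorem isLogConcave_volume_coordSlice {n : ℕ} (i : Fin (n + 1)) {K : Set (Fin (n + 1) → ℝ)}
    (hK : IsCompact K) (hconv : Convex ℝ K) :
    IsLogConcave fun t => volume.real (coordSlice i K t) := by
  intro s t hs ht hst a b
  have hind : ∀ c : ℝ, ∫⁻ y, (coordSlice i K c).indicator (1 : (Fin n → ℝ) → ℝ≥0∞) y =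
      volume (coordSlice i K c) := fun c =>
    lintegral_indicator_one (measurableSet_coordSlice i hK.measurableSet c)
  have hmeas : ∀ c : ℝ, Measurable ((coordSlice i K c).indicator (1 : (Fin n → ℝ) → ℝ≥0∞)) :=
    fun c => measurable_one.indicator (measurableSet_coordSlice i hK.measurableSet c)
  have key := prekopa_leindler (hmeas a) (hmeas b) (hmeas (s * a + t * b)) hs ht hst (by
    intro x y
    by_cases hx : x ∈ coordSlice i K a
    · by_cases hy : y ∈ coordSlice i K b
      · have : s • x + t • y ∈ coordSlice i K (s * a + t * b) := by
          have h := hconv hx hy hs.le ht.le hst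
          have e : i.insertNth (s * a + t * b) (s • x + t • y) =
              s • (i.insertNth a x : Fin (n + 1) → ℝ) + t • i.insertNth b y := by
            ext j
            refine Fin.succAboveCases i ?_ (fun j => ?_) j <;> simp
          change i.insertNth (s * a + t * b) (s • x + t • y) ∈ K
          rwa [e]
        simp [indicator_of_mem hx, indicator_of_mem hy, indicator_of_mem this]
      · simp [indicator_of_notMem hy, ht]
    · simp [indicator_of_notMem hx, hs])
  rw [hind, hind, hind] at key
  have := ENNReal.toReal_mono (volume_coordSlice_ne_top i hK _) key
  rwa [ENNReal.toReal_mul, ← ENNReal.toReal_rpow, ← ENNReal.toReal_rpow] at this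

/-- A Remez-type estimate on a convex body for a polynomial in one of the coordinates. -/
theorem Convex.volume_real_coord_sublevel_le {n : ℕ} (i : Fin (n + 1))
    {K : Set (Fin (n + 1) → ℝ)} (hconv : Convex ℝ K) (hK : IsCompact K)
    (hpos : 0 < volume.real K) {p : Polynomial ℝ} {d : ℕ} (hd : 0 < d) (hp : p.natDegree ≤ d)
    {ε c u : ℝ} (hε : 0 < ε) (hc : 0 < c) (hu : 0 < u)
    (hU : u * volume.real K ≤ volume.real (K ∩ {x | c ^ d ≤ |p.eval (x i)|})) :
    volume.real (K ∩ {x | |p.eval (x i)| ≤ ε ^ d}) ≤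
      2 * Real.exp 1 * (ε / c) * (1 + Real.log (1 / u)) * volume.real K := by
  have hKm := hK.measurableSet
  set f : ℝ → ℝ := fun t => volume.real (coordSlice i K t) with hf
  have hfm : Measurable f := (measurable_volume_coordSlice i hKm).ennreal_toReal
  have h0 : ∀ t, 0 ≤ f t := fun t => measureReal_nonneg
  have hint : ∀ S : Set ℝ, MeasurableSet S →
      ∫ t in S, f t = volume.real (K ∩ {x | x i ∈ S}) := fun S hS => by
    rw [integral_eq_lintegral_of_nonneg_ae (ae_of_all _ h0) hfm.aestronglyMeasurable,
      measureReal_def, ← setLIntegral_volume_coordSlice i hKm hS]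
    congr 2
    ext t
    exact ofReal_measureReal (volume_coordSlice_ne_top i hK t)
  have hint' : ∫ t, f t = volume.real K := by
    rw [← setIntegral_univ, hint _ MeasurableSet.univ]; simp
  have hfi : Integrable f := by
    by_contra h
    rw [integral_undef h] at hint'
    exact hpos.ne hint'
  have hne : K.Nonempty := nonempty_of_measureReal_ne_zero hpos.ne'
  obtain ⟨m, hm⟩ := exists_forall_volume_coordSlice_le i hK hne
  have hUc : IsClosed {t : ℝ | c ^ d ≤ |p.eval t|} := isClosed_le continuous_const (by fun_prop)
  have hEc : IsClosed {t : ℝ | |p.eval t| ≤ ε ^ d} := isClosed_le (by fun_prop) continuous_const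
  have := (isLogConcave_volume_coordSlice i hK hconv).setIntegral_le hfm hfi h0
    (fun t => ENNReal.toReal_mono (volume_coordSlice_ne_top i hK m) (hm t)) hUc
    (E := {t : ℝ | |p.eval t| ≤ ε ^ d}) (δ := 2 * Real.exp 1 * (ε / c)) (by positivity) hu
    (hint' ▸ hpos) (by rw [hint', hint _ hUc.measurableSet]; exact hU)
    (by
      intro b hb x hx y hy
      rw [← ofReal_measureReal ((measure_mono inter_subset_right).trans_lt measure_Icc_lt_top).ne]
      exact ENNReal.ofReal_le_ofReal
        (Polynomial.volume_real_sublevel_le hd hp ⟨hx, hy⟩ hε.le hc hb))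
  rwa [hint _ hEc.measurableSet, hint'] at this

theorem volume_setOf_linear_combination_eq_zero {ι : Type*} [Fintype ι] {i k : ι} (hik : i ≠ k)
    {α β : ℝ} (h : α ≠ 0 ∨ β ≠ 0) (a b : ℝ) :
    volume {x : ι → ℝ | α * (x i - a) + β * (x k - b) = 0} = 0 := by
  classical
  let s : AffineSubspace ℝ (ι → ℝ) :=
    { carrier := {x | α * (x i - a) + β * (x k - b) = 0}
      smul_vsub_vadd_mem' := by
        intro c x y z hx hy hz
        simp only [mem_ofPred_eq, vsub_eq_sub, vadd_eq_add, Pi.add_apply, Pi.smul_apply,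
          Pi.sub_apply, smul_eq_mul] at *
        linear_combination c * hx - c * hy + hz }
  refine Measure.addHaar_affineSubspace volume s fun hs => ?_
  have hmem : ∀ x : ι → ℝ, α * (x i - a) + β * (x k - b) = 0 := fun x => by
    have : x ∈ s := hs ▸ AffineSubspace.mem_top ℝ _ x
    exact this
  have h0 := hmem 0
  have h1 := hmem (Pi.single i 1)
  have h2 := hmem (Pi.single k 1)
  simp [hik, hik.symm] at h0 h1 h2
  rcases h with h | h
  · exact h (by linarith)
  · exact h (by linarith)

theorem volume_real_inter_half_add {ι : Type*} [Fintype ι] {i k : ι} (hik : i ≠ k)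
    {α β : ℝ} (h : α ≠ 0 ∨ β ≠ 0) (a b : ℝ) {S : Set (ι → ℝ)} (hS : volume S ≠ ∞) :
    volume.real (S ∩ {x | 0 ≤ α * (x i - a) + β * (x k - b)}) +
      volume.real (S ∩ {x | 0 ≤ -α * (x i - a) + -β * (x k - b)}) = volume.real S := by
  have hm : MeasurableSet {x : ι → ℝ | 0 ≤ α * (x i - a) + β * (x k - b)} :=
    (isClosed_le continuous_const (by fun_prop)).measurableSet
  rw [← measureReal_inter_add_sdiff (μ := volume) (s := S) hm hS]
  congr 1
  refine measureReal_congr ?_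
  have h0 : ∀ᵐ x : ι → ℝ, α * (x i - a) + β * (x k - b) ≠ 0 :=
    compl_mem_ae_iff.2 (volume_setOf_linear_combination_eq_zero hik h a b)
  filter_upwards [h0] with x hx
  apply propext
  change (x ∈ S ∧ 0 ≤ -α * (x i - a) + -β * (x k - b)) ↔
    (x ∈ S ∧ ¬ 0 ≤ α * (x i - a) + β * (x k - b))
  refine and_congr_right fun _ => ?_
  rw [not_le]
  constructor
  · intro h'
    exact lt_of_le_of_ne (by linarith) hx
  · intro h'
    linarith

theorem continuous_volume_real_inter_half {ι : Type*} [Fintype ι] {i k : ι} (hik : i ≠ k)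
    (a b : ℝ) {S : Set (ι → ℝ)} (hS : volume S ≠ ∞) :
    Continuous fun θ : ℝ => volume.real
      (S ∩ {x | 0 ≤ Real.cos θ * (x i - a) + Real.sin θ * (x k - b)}) := by
  set H : ℝ → Set (ι → ℝ) := fun θ => {x | 0 ≤ Real.cos θ * (x i - a) + Real.sin θ * (x k - b)}
  have hm : ∀ θ, MeasurableSet (H θ) := fun θ =>
    (isClosed_le continuous_const (by fun_prop)).measurableSet
  have e : ∀ θ, volume.real (S ∩ H θ) = ∫ x in S, (H θ).indicator (fun _ => (1 : ℝ)) x := by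
    intro θ
    rw [integral_indicator (hm θ), Measure.restrict_restrict (hm θ), setIntegral_const,
      inter_comm]
    simp
  change Continuous fun θ => volume.real (S ∩ H θ)
  simp_rw [e]
  refine continuous_iff_continuousAt.2 fun θ₀ => ?_
  refine continuousAt_of_dominated (bound := fun _ => 1)
    (Filter.Eventually.of_forall fun θ =>
      (measurable_const.indicator (hm θ)).aestronglyMeasurable)
    (Filter.Eventually.of_forall fun θ => ae_of_all _ fun x => ?_) ?_ ?_
  · rw [Real.norm_eq_abs, abs_of_nonneg (indicator_nonneg (fun _ _ => zero_le_one) _)]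
    exact indicator_le_self' (fun _ _ => zero_le_one) _
  · exact integrableOn_const hS
  · have hne : Real.cos θ₀ ≠ 0 ∨ Real.sin θ₀ ≠ 0 := by
      by_contra! h
      have := Real.sin_sq_add_cos_sq θ₀
      rw [h.1, h.2] at this
      norm_num at this
    have h0 : ∀ᵐ x : ι → ℝ, Real.cos θ₀ * (x i - a) + Real.sin θ₀ * (x k - b) ≠ 0 :=
      compl_mem_ae_iff.2 (volume_setOf_linear_combination_eq_zero hik hne a b)
    refine ae_restrict_of_ae ?_
    filter_upwards [h0] with x hx
    have hc : Continuous fun θ : ℝ => Real.cos θ * (x i - a) + Real.sin θ * (x k - b) := by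
      fun_prop
    rcases lt_or_gt_of_ne hx with h | h
    · refine continuousAt_const.congr (f := fun _ => (0 : ℝ)) ?_
      filter_upwards [hc.continuousAt.eventually (gt_mem_nhds h)] with θ hθ
      have : x ∉ H θ := not_le.2 hθ
      simp only [indicator_of_notMem this]
    · refine continuousAt_const.congr (f := fun _ => (1 : ℝ)) ?_
      filter_upwards [hc.continuousAt.eventually (lt_mem_nhds h)] with θ hθ
      have : x ∈ H θ := hθ.le
      simp only [indicator_of_mem this]

/-- The invariants kept along the bisection procedure. -/
structure IsBisectionBody {ι : Type*} [Fintype ι] (A B : Set (ι → ℝ)) (u w : ℝ)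
    (K : Set (ι → ℝ)) : Prop where
  isCompact : IsCompact K
  convex : Convex ℝ K
  eq : volume.real (K ∩ A) = u * volume.real K
  lt : w * volume.real K < volume.real (K ∩ B)

theorem IsBisectionBody.volume_real_pos {ι : Type*} [Fintype ι] {A B : Set (ι → ℝ)} {u w : ℝ}
    {K : Set (ι → ℝ)} (h : IsBisectionBody A B u w K) : 0 < volume.real K := by
  refine measureReal_nonneg.lt_of_ne fun h0 => ?_
  have h1 := h.lt
  have h2 : volume.real (K ∩ B) ≤ volume.real K :=
    measureReal_mono inter_subset_left h.isCompact.measure_lt_top.ne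
  rw [← h0] at h1 h2
  linarith

theorem IsBisectionBody.nonempty {ι : Type*} [Fintype ι] {A B : Set (ι → ℝ)} {u w : ℝ}
    {K : Set (ι → ℝ)} (h : IsBisectionBody A B u w K) : K.Nonempty :=
  nonempty_of_measureReal_ne_zero h.volume_real_pos.ne'

theorem IsBisectionBody.exists_half {ι : Type*} [Fintype ι] {A B : Set (ι → ℝ)}
    {u w : ℝ} {K : Set (ι → ℝ)} (h : IsBisectionBody A B u w K) {i k : ι} (hik : i ≠ k)
    (a b : ℝ) : ∃ K' ⊆ K, IsBisectionBody A B u w K' ∧ ∃ α β : ℝ, (α ≠ 0 ∨ β ≠ 0) ∧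
      ∀ x ∈ K', 0 ≤ α * (x i - a) + β * (x k - b) := by
  have hfin : ∀ S, volume (K ∩ S) ≠ ∞ := fun S =>
    ((measure_mono inter_subset_left).trans_lt h.isCompact.measure_lt_top).ne
  have hne : ∀ θ, Real.cos θ ≠ 0 ∨ Real.sin θ ≠ 0 := by
    intro θ
    by_contra! h
    have := Real.sin_sq_add_cos_sq θ
    rw [h.1, h.2] at this
    norm_num at this
  set H : ℝ → ℝ → Set (ι → ℝ) := fun α β => {x | 0 ≤ α * (x i - a) + β * (x k - b)} with hH
  have hHc : ∀ α β, IsClosed (H α β) := fun α β => isClosed_le continuous_const (by fun_prop)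
  have hHconv : ∀ α β, Convex ℝ (H α β) := by
    intro α β x hx y hy s t hs ht hst
    simp only [hH, mem_ofPred_eq, Pi.add_apply, Pi.smul_apply, smul_eq_mul] at *
    have e : α * (s * x i + t * y i - a) + β * (s * x k + t * y k - b) =
        s * (α * (x i - a) + β * (x k - b)) + t * (α * (y i - a) + β * (y k - b)) := by
      linear_combination (α * a + β * b) * hst
    rw [e]
    positivity
  set φ : ℝ → ℝ := fun θ => volume.real (K ∩ A ∩ H (Real.cos θ) (Real.sin θ)) -
    u * volume.real (K ∩ H (Real.cos θ) (Real.sin θ)) with hφ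
  have hcont : Continuous φ :=
    (continuous_volume_real_inter_half hik a b (hfin A)).sub
      ((continuous_volume_real_inter_half hik a b h.isCompact.measure_lt_top.ne).const_mul u)
  have hsplit : ∀ α β : ℝ, (α ≠ 0 ∨ β ≠ 0) → ∀ S, volume.real (K ∩ S ∩ H α β) +
      volume.real (K ∩ S ∩ H (-α) (-β)) = volume.real (K ∩ S) :=
    fun α β hαβ S => volume_real_inter_half_add hik hαβ a b (hfin S)
  have hsplit' : ∀ α β : ℝ, (α ≠ 0 ∨ β ≠ 0) → volume.real (K ∩ H α β) +
      volume.real (K ∩ H (-α) (-β)) = volume.real K :=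
    fun α β hαβ => volume_real_inter_half_add hik hαβ a b h.isCompact.measure_lt_top.ne
  have hodd : φ 0 + φ Real.pi = 0 := by
    have h1 := hsplit _ _ (hne 0) A
    have h2 := hsplit' _ _ (hne 0)
    have h3 := h.eq
    simp only [hφ, Real.cos_pi, Real.sin_pi, Real.cos_zero, Real.sin_zero, neg_zero] at *
    linear_combination h1 - u * h2 + h3
  obtain ⟨θ, hθ⟩ : ∃ θ, φ θ = 0 := by
    have hr : (0 : ℝ) ∈ range φ := by
      refine mem_range_of_exists_le_of_exists_ge hcont ?_ ?_
      · rcases le_total (φ 0) 0 with h | h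
        · exact ⟨0, h⟩
        · exact ⟨Real.pi, by linarith⟩
      · rcases le_total (φ 0) 0 with h | h
        · exact ⟨Real.pi, by linarith⟩
        · exact ⟨0, h⟩
    exact hr
  set α := Real.cos θ
  set β := Real.sin θ
  have hαβ : α ≠ 0 ∨ β ≠ 0 := hne θ
  have hA1 : volume.real (K ∩ A ∩ H α β) = u * volume.real (K ∩ H α β) := sub_eq_zero.1 hθ
  have hA2 : volume.real (K ∩ A ∩ H (-α) (-β)) = u * volume.real (K ∩ H (-α) (-β)) := by
    linear_combination hsplit α β hαβ A - u * hsplit' α β hαβ + h.eq - hA1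
  by_cases hB : w * volume.real (K ∩ H α β) < volume.real (K ∩ B ∩ H α β)
  · refine ⟨K ∩ H α β, inter_subset_left, ⟨h.isCompact.inter_right (hHc _ _),
      h.convex.inter (hHconv _ _), ?_, ?_⟩, α, β, hαβ, fun x hx => hx.2⟩
    · rw [inter_right_comm, hA1]
    · rwa [inter_right_comm]
  · refine ⟨K ∩ H (-α) (-β), inter_subset_left, ⟨h.isCompact.inter_right (hHc _ _),
      h.convex.inter (hHconv _ _), ?_, ?_⟩, -α, -β, by simpa using hαβ, fun x hx => hx.2⟩
    · rw [inter_right_comm, hA2]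
    · rw [inter_right_comm]
      have h1 := hsplit α β hαβ B
      have h2 := hsplit' α β hαβ
      have h3 := h.lt
      rw [← h1, ← h2, mul_add] at h3
      linarith

theorem exists_rat_barycentric_pos {p q z p' q' z' : ℝ}
    (hD : (q - p) * (z' - p') - (q' - p') * (z - p) ≠ 0) :
    ∃ a b : ℚ, ∃ s₁ s₂ s₃ : ℝ, 0 < s₁ ∧ 0 < s₂ ∧ 0 < s₃ ∧
      s₁ * (p - a) + s₂ * (q - a) + s₃ * (z - a) = 0 ∧
      s₁ * (p' - b) + s₂ * (q' - b) + s₃ * (z' - b) = 0 := by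
  set D := (q - p) * (z' - p') - (q' - p') * (z - p) with hDdef
  set s₂ : ℝ × ℝ → ℝ := fun r => ((r.1 - p) * (z' - p') - (r.2 - p') * (z - p)) / D
  set s₃ : ℝ × ℝ → ℝ := fun r => ((q - p) * (r.2 - p') - (q' - p') * (r.1 - p)) / D
  have h₂ : Continuous s₂ := by fun_prop
  have h₃ : Continuous s₃ := by fun_prop
  have hO : IsOpen {r : ℝ × ℝ | 0 < s₂ r ∧ 0 < s₃ r ∧ 0 < 1 - s₂ r - s₃ r} :=
    (isOpen_lt continuous_const h₂).inter ((isOpen_lt continuous_const h₃).inter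
      (isOpen_lt continuous_const ((continuous_const.sub h₂).sub h₃)))
  have hne : ((p + q + z) / 3, (p' + q' + z') / 3) ∈
      {r : ℝ × ℝ | 0 < s₂ r ∧ 0 < s₃ r ∧ 0 < 1 - s₂ r - s₃ r} := by
    have e₂ : s₂ ((p + q + z) / 3, (p' + q' + z') / 3) = 1 / 3 := by
      simp only [s₂]; rw [div_eq_iff hD, hDdef]; ring
    have e₃ : s₃ ((p + q + z) / 3, (p' + q' + z') / 3) = 1 / 3 := by
      simp only [s₃]; rw [div_eq_iff hD, hDdef]; ring
    rw [mem_ofPred_eq, e₂, e₃]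
    norm_num
  obtain ⟨⟨a, b⟩, hab⟩ := (Rat.denseRange_cast (𝕜 := ℝ)).prodMap
    (Rat.denseRange_cast (𝕜 := ℝ)) |>.exists_mem_open hO ⟨_, hne⟩
  refine ⟨a, b, _, _, _, hab.2.2, hab.1, hab.2.1, ?_, ?_⟩
  · simp only [s₂, s₃, Prod.map_apply]
    field_simp
    rw [hDdef]; ring
  · simp only [s₂, s₃, Prod.map_apply]
    field_simp
    rw [hDdef]; ring

theorem exists_subset_line {ι : Type*} [Nonempty ι] {S : Set (ι → ℝ)} (hne : S.Nonempty)
    (hS : ∀ i k : ι, i ≠ k → ∀ a b : ℚ, ∃ α β : ℝ, (α ≠ 0 ∨ β ≠ 0) ∧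
      ∀ x ∈ S, 0 ≤ α * (x i - a) + β * (x k - b)) :
    ∃ (i : ι) (a v : ι → ℝ), ∀ x ∈ S, ∀ k, x k = a k + v k * x i := by
  by_cases hconst : ∀ i, ∀ x ∈ S, ∀ y ∈ S, x i = y i
  · obtain ⟨x₀, hx₀⟩ := hne
    exact ⟨Classical.arbitrary ι, x₀, 0, fun x hx k => by simp [hconst k x hx x₀ hx₀]⟩
  push Not at hconst
  obtain ⟨i, p, hp, q, hq, hpq⟩ := hconst
  have hqp : q i - p i ≠ 0 := sub_ne_zero.2 hpq.symm
  refine ⟨i, fun k => p k - (q k - p k) / (q i - p i) * p i,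
    fun k => (q k - p k) / (q i - p i), fun z hz k => ?_⟩
  by_cases hik : i = k
  · subst hik
    field_simp
    ring
  by_contra hcon
  have hD : (q i - p i) * (z k - p k) - (q k - p k) * (z i - p i) ≠ 0 := by
    intro h
    apply hcon
    field_simp
    linear_combination h
  obtain ⟨a, b, s₁, s₂, s₃, h₁, h₂, h₃, e, e'⟩ := exists_rat_barycentric_pos hD
  obtain ⟨α, β, hαβ, hL⟩ := hS i k hik a b
  have hLp := hL p hp
  have hLq := hL q hq
  have hLz := hL z hz
  have hsum : s₁ * (α * (p i - a) + β * (p k - b)) + s₂ * (α * (q i - a) + β * (q k - b)) +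
      s₃ * (α * (z i - a) + β * (z k - b)) = 0 := by
    linear_combination α * e + β * e'
  have m₁ := mul_nonneg h₁.le hLp
  have m₂ := mul_nonneg h₂.le hLq
  have m₃ := mul_nonneg h₃.le hLz
  have z₁ := (mul_eq_zero.1 (show s₁ * (α * (p i - a) + β * (p k - b)) = 0 by linarith)).resolve_left
    h₁.ne'
  have z₂ := (mul_eq_zero.1 (show s₂ * (α * (q i - a) + β * (q k - b)) = 0 by linarith)).resolve_left
    h₂.ne'
  have z₃ := (mul_eq_zero.1 (show s₃ * (α * (z i - a) + β * (z k - b)) = 0 by linarith)).resolve_left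
    h₃.ne'
  have hα : α * ((q i - p i) * (z k - p k) - (q k - p k) * (z i - p i)) = 0 := by
    linear_combination (z k - p k) * (z₂ - z₁) - (q k - p k) * (z₃ - z₁)
  have hβ : β * ((q i - p i) * (z k - p k) - (q k - p k) * (z i - p i)) = 0 := by
    linear_combination (q i - p i) * (z₃ - z₁) - (z i - p i) * (z₂ - z₁)
  rcases hαβ with h | h
  · exact h ((mul_eq_zero.1 hα).resolve_right hD)
  · exact h ((mul_eq_zero.1 hβ).resolve_right hD)

/-- Localization by repeated bisection: a body can be shrunk, keeping prescribed volume ratios,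
into an arbitrarily thin neighbourhood of a line. -/
theorem IsBisectionBody.exists_thin {ι : Type*} [Fintype ι] [Nonempty ι] {A B : Set (ι → ℝ)}
    {u w : ℝ} {F : Set (ι → ℝ)} (hF : IsBisectionBody A B u w F) :
    ∃ (i : ι) (a v : ι → ℝ), ∀ η > 0, ∃ K ⊆ F, IsBisectionBody A B u w K ∧
      ∀ x ∈ K, ∀ k, |x k - (a k + v k * x i)| < η := by
  obtain ⟨e, he⟩ := exists_surjective_nat (ι × ι × ℚ × ℚ)
  have step : ∀ (q : ι × ι × ℚ × ℚ) (K : {K // IsBisectionBody A B u w K}),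
      ∃ K' : {K // IsBisectionBody A B u w K}, K'.1 ⊆ K.1 ∧ (q.1 ≠ q.2.1 →
        ∃ α β : ℝ, (α ≠ 0 ∨ β ≠ 0) ∧
          ∀ x ∈ K'.1, 0 ≤ α * (x q.1 - q.2.2.1) + β * (x q.2.1 - q.2.2.2)) := by
    rintro q ⟨K, hK⟩
    by_cases hq : q.1 = q.2.1
    · exact ⟨⟨K, hK⟩, subset_rfl, fun h => absurd hq h⟩
    · obtain ⟨K', hsub, hK', h⟩ := hK.exists_half hq (q.2.2.1 : ℝ) (q.2.2.2 : ℝ)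
      exact ⟨⟨K', hK'⟩, hsub, fun _ => h⟩
  choose g hgsub hg using step
  let T : ℕ → {K // IsBisectionBody A B u w K} := fun j => Nat.rec ⟨F, hF⟩ (fun j K => g (e j) K) j
  have hT : ∀ j, T (j + 1) = g (e j) (T j) := fun j => rfl
  have hsucc : ∀ j, (T (j + 1)).1 ⊆ (T j).1 := fun j => hT j ▸ hgsub _ _
  have hanti : Antitone fun j => (T j).1 := antitone_nat_of_succ_le hsucc
  have hne : (⋂ j, (T j).1).Nonempty :=
    IsCompact.nonempty_iInter_of_sequence_nonempty_isCompact_isClosed _ hsucc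
      (fun j => (T j).2.nonempty) (T 0).2.isCompact fun j => (T j).2.isCompact.isClosed
  obtain ⟨i, a, v, hline⟩ := exists_subset_line hne (by
    intro i k hik r₁ r₂
    obtain ⟨j, hj⟩ := he (i, k, r₁, r₂)
    obtain ⟨α, β, hαβ, h⟩ := hg (e j) (T j) (by rw [hj]; exact hik)
    refine ⟨α, β, hαβ, fun x hx => ?_⟩
    have := h x (hT j ▸ mem_iInter.1 hx (j + 1))
    rwa [hj] at this)
  refine ⟨i, a, v, fun η hη => ?_⟩
  have hO : IsOpen {x : ι → ℝ | ∀ k, |x k - (a k + v k * x i)| < η} := by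
    simp only [ofPred_forall]
    exact isOpen_iInter_of_finite fun k => isOpen_lt (by fun_prop) continuous_const
  obtain ⟨j, hj⟩ := exists_subset_nhds_of_isCompact (V := fun j => (T j).1)
    (directed_of_isDirected_le hanti) (fun j => (T j).2.isCompact)
    (U := {x : ι → ℝ | ∀ k, |x k - (a k + v k * x i)| < η}) (fun x hx => hO.mem_nhds (by
      intro k
      rw [← hline x hx k]
      simpa using hη))
  exact ⟨(T j).1, hanti (Nat.zero_le j), (T j).2, fun x hx k => hj hx k⟩

theorem exists_forall_abs_eval_sub_lt {ι : Type*} [Fintype ι] (P : MvPolynomial ι ℝ)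
    {F : Set (ι → ℝ)} (hF : IsCompact F) {ρ : ℝ} (hρ : 0 < ρ) :
    ∃ η > 0, ∀ x ∈ F, ∀ y, (∀ k, |x k - y k| < η) →
      |MvPolynomial.eval x P - MvPolynomial.eval y P| < ρ := by
  have h := hF.uniformContinuousAt_of_continuousAt (fun x : ι → ℝ => MvPolynomial.eval x P)
    (fun x _ => (MvPolynomial.continuous_eval P).continuousAt) (Metric.dist_mem_uniformity hρ)
  obtain ⟨η, hη, h⟩ := Metric.mem_uniformity_dist.1 h
  refine ⟨η, hη, fun x hx y hxy => ?_⟩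
  exact h ((dist_pi_lt_iff hη).2 fun k => hxy k) hx

/-- A Remez-type inequality for polynomials on convex bodies of unit volume. -/
theorem volume_real_sublevel_le {n : ℕ} {P : MvPolynomial (Fin (n + 1)) ℝ} {d : ℕ} (hd : 0 < d)
    (hP : P.totalDegree ≤ d) {F : Set (Fin (n + 1) → ℝ)} (hF : IsCompact F)
    (hconv : Convex ℝ F) (hvol : volume.real F = 1) {ε c : ℝ} (hε : 0 < ε) (hc : 0 < c)
    (hpos : 0 < volume.real (F ∩ {x | c ^ d ≤ |MvPolynomial.eval x P|})) :
    volume.real (F ∩ {x | |MvPolynomial.eval x P| ≤ ε ^ d}) ≤ 2 * Real.exp 1 * (ε / c) *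
      (1 + Real.log (1 / volume.real (F ∩ {x | c ^ d ≤ |MvPolynomial.eval x P|}))) := by
  set A := {x | c ^ d ≤ |MvPolynomial.eval x P|}
  set B := {x | |MvPolynomial.eval x P| ≤ ε ^ d}
  set u := volume.real (F ∩ A)
  have hu1 : u ≤ 1 := hvol ▸ measureReal_mono inter_subset_left hF.measure_lt_top.ne
  have hlog : 0 ≤ Real.log (1 / u) := Real.log_nonneg ((one_le_div hpos).2 hu1)
  set R := 2 * Real.exp 1 * (ε / c) * (1 + Real.log (1 / u)) with hR
  have hR0 : 0 < R := by positivity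
  by_contra! hlt
  obtain ⟨w, hRw, hw⟩ := exists_between hlt
  set s := Real.sqrt (w / R)
  have hs2 : s * s = w / R := Real.mul_self_sqrt (div_nonneg (hR0.le.trans hRw.le) hR0.le)
  have hs1 : 1 < s := by
    rw [← Real.sqrt_one]
    exact Real.sqrt_lt_sqrt zero_le_one ((one_lt_div hR0).2 hRw)
  have hs0 : 0 < s := zero_lt_one.trans hs1
  have hε' : ε ^ d < (s * ε) ^ d := pow_lt_pow_left₀ (by nlinarith) hε.le hd.ne'
  have hc' : (c / s) ^ d < c ^ d := pow_lt_pow_left₀ (div_lt_self hc hs1) (by positivity) hd.ne'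
  have hbody : IsBisectionBody A B u w F :=
    ⟨hF, hconv, by rw [hvol, mul_one], by rwa [hvol, mul_one]⟩
  obtain ⟨i, a, v, hthin⟩ := hbody.exists_thin
  obtain ⟨η, hη, hcont⟩ := exists_forall_abs_eval_sub_lt P hF
    (lt_min (sub_pos.2 hε') (sub_pos.2 hc'))
  obtain ⟨K, hKF, hK, hKline⟩ := hthin η hη
  set p : Polynomial ℝ :=
    MvPolynomial.aeval (fun k => Polynomial.C (a k) + Polynomial.C (v k) * Polynomial.X) P with hp
  have heval : ∀ t, p.eval t = MvPolynomial.eval (fun k => a k + v k * t) P := by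
    intro t
    have h := MvPolynomial.map_aeval
      (fun k => Polynomial.C (a k) + Polynomial.C (v k) * Polynomial.X) (Polynomial.evalRingHom t) P
    rw [Polynomial.coe_evalRingHom] at h
    rw [hp, h]
    simp only [Polynomial.eval_add, Polynomial.eval_mul, Polynomial.eval_C, Polynomial.eval_X]
    rw [MvPolynomial.eval, MvPolynomial.coe_eval₂Hom]
    congr 1
    ext x
    simp
  have hdeg : p.natDegree ≤ d := by
    refine (MvPolynomial.aeval_natDegree_le P hP _ fun k => ?_).trans (mul_one d).le
    compute_degree
  have hclose : ∀ x ∈ K, |MvPolynomial.eval x P - p.eval (x i)| <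
      min ((s * ε) ^ d - ε ^ d) (c ^ d - (c / s) ^ d) := fun x hx => by
    rw [heval]
    exact hcont x (hKF hx) _ (hKline x hx)
  have hfin : ∀ S, volume (K ∩ S) ≠ ∞ := fun S =>
    ((measure_mono inter_subset_left).trans_lt hK.isCompact.measure_lt_top).ne
  have hA : u * volume.real K ≤ volume.real (K ∩ {x | (c / s) ^ d ≤ |p.eval (x i)|}) := by
    rw [← hK.eq]
    refine measureReal_mono (fun x hx => ⟨hx.1, ?_⟩) (hfin _)
    have h1 := (hclose x hx.1).trans_le (min_le_right _ _)
    have h2 := abs_sub_abs_le_abs_sub (MvPolynomial.eval x P) (p.eval (x i))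
    have h3 : c ^ d ≤ |MvPolynomial.eval x P| := hx.2
    rw [mem_ofPred_eq]
    linarith
  have hB : volume.real (K ∩ B) ≤ volume.real (K ∩ {x | |p.eval (x i)| ≤ (s * ε) ^ d}) := by
    refine measureReal_mono (fun x hx => ⟨hx.1, ?_⟩) (hfin _)
    have h1 := (hclose x hx.1).trans_le (min_le_left _ _)
    have h2 := abs_sub_abs_le_abs_sub (p.eval (x i)) (MvPolynomial.eval x P)
    rw [abs_sub_comm] at h2
    have h3 : |MvPolynomial.eval x P| ≤ ε ^ d := hx.2
    rw [mem_ofPred_eq]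
    linarith
  have main := hK.convex.volume_real_coord_sublevel_le i hK.isCompact hK.volume_real_pos hd hdeg
    (mul_pos hs0 hε) (div_pos hc hs0) hpos hA
  have e : 2 * Real.exp 1 * (s * ε / (c / s)) * (1 + Real.log (1 / u)) = w := by
    calc _ = (s * s) * R := by rw [hR]; field_simp
      _ = w := by rw [hs2]; field_simp
  rw [e] at main
  exact absurd hK.lt (not_lt.2 (hB.trans main))

theorem setLIntegral_Ioc_rpow_sub_one {p a : ℝ} (hp : 0 < p) (ha : 0 ≤ a) :
    ∫⁻ t in Ioc 0 a, ENNReal.ofReal (t ^ (p - 1)) = ENNReal.ofReal (a ^ p / p) := by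
  have hi : IntegrableOn (fun t : ℝ => t ^ (p - 1)) (Ioc 0 a) := by
    rw [← intervalIntegrable_iff_integrableOn_Ioc_of_le ha]
    exact intervalIntegral.intervalIntegrable_rpow' (by linarith)
  rw [← ofReal_integral_eq_lintegral_ofReal hi, ← intervalIntegral.integral_of_le ha,
    integral_rpow (Or.inl (by linarith))]
  · simp [hp.ne']
  · filter_upwards [ae_restrict_mem measurableSet_Ioc] with t ht
    exact Real.rpow_nonneg ht.1.le _

theorem lintegral_rpow_le_of_tail {Ω : Type*} [MeasurableSpace Ω] {μ : Measure Ω}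
    [IsProbabilityMeasure μ] {X : Ω → ℝ} (hX : Measurable X) (h0 : ∀ x, 0 ≤ X x) {p a : ℝ}
    (hp : 0 < p) (ha : 0 ≤ a) {k : ℝ → ℝ} (hk0 : ∀ t > a, 0 ≤ k t)
    (tail : ∀ t > a, μ {x | t ≤ X x} * ENNReal.ofReal (t ^ (p - 1)) ≤ ENNReal.ofReal (k t))
    (hk : IntegrableOn k (Ioi a)) :
    ∫⁻ x, ENNReal.ofReal (X x ^ p) ∂μ ≤ ENNReal.ofReal (a ^ p + p * ∫ t in Ioi a, k t) := by
  have hint : 0 ≤ ∫ t in Ioi a, k t :=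
    setIntegral_nonneg measurableSet_Ioi fun t ht => hk0 t ht
  rw [lintegral_rpow_eq_lintegral_meas_le_mul _ (ae_of_all _ h0) hX.aemeasurable hp,
    ← Ioc_union_Ioi_eq_Ioi ha, lintegral_union measurableSet_Ioi
      (disjoint_left.2 fun x hx hx' => absurd hx.2 (not_le.2 hx'))]
  have h1 : ∫⁻ t in Ioc 0 a, μ {x | t ≤ X x} * ENNReal.ofReal (t ^ (p - 1)) ≤
      ENNReal.ofReal (a ^ p / p) := by
    rw [← setLIntegral_Ioc_rpow_sub_one hp ha]
    exact lintegral_mono fun t => mul_le_of_le_one_left bot_le prob_le_one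
  have h2 : ∫⁻ t in Ioi a, μ {x | t ≤ X x} * ENNReal.ofReal (t ^ (p - 1)) ≤
      ENNReal.ofReal (∫ t in Ioi a, k t) := by
    rw [ofReal_integral_eq_lintegral_ofReal hk
      ((ae_restrict_mem measurableSet_Ioi).mono fun t ht => hk0 t ht)]
    exact setLIntegral_mono' measurableSet_Ioi tail
  have h3 : 0 ≤ a ^ p / p := div_nonneg (Real.rpow_nonneg ha _) hp.le
  calc _ ≤ ENNReal.ofReal p * (ENNReal.ofReal (a ^ p / p) + ENNReal.ofReal (∫ t in Ioi a, k t)) := by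
        gcongr
    _ = _ := by
        rw [← ENNReal.ofReal_add h3 hint, ← ENNReal.ofReal_mul hp.le]
        congr 1
        field_simp

theorem lintegral_rpow_le_of_exp_tail_of_one_le {Ω : Type*} [MeasurableSpace Ω] {μ : Measure Ω}
    [IsProbabilityMeasure μ] {X : Ω → ℝ} (hX : Measurable X) (h0 : ∀ x, 0 ≤ X x)
    (tail : ∀ t > 0, μ {x | t ≤ X x} ≤ ENNReal.ofReal (Real.exp (1 - t))) {p : ℝ} (hp : 1 ≤ p) :
    ∫⁻ x, ENNReal.ofReal (X x ^ p) ∂μ ≤ ENNReal.ofReal ((2 * p) ^ p) := by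
  have hp0 : 0 < p := by linarith
  have hpp : -(1 / p) < 0 := by simpa using hp0
  refine (lintegral_rpow_le_of_tail hX h0 hp0 zero_le_one
    (k := fun t => p ^ (p - 1) * Real.exp (2 - p) * Real.exp (-(1 / p) * t))
    (fun t _ => by positivity) (fun t ht => ?_)
    ((integrableOn_exp_mul_Ioi hpp 1).const_mul _)).trans (ENNReal.ofReal_le_ofReal ?_)
  · have ht0 : 0 < t := zero_lt_one.trans ht
    refine (mul_le_mul_left (tail t ht0) _).trans ?_
    rw [← ENNReal.ofReal_mul (Real.exp_pos _).le]
    refine ENNReal.ofReal_le_ofReal ?_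
    have h1 : t / p ≤ Real.exp (t / p - 1) := by linarith [Real.add_one_le_exp (t / p - 1)]
    calc Real.exp (1 - t) * t ^ (p - 1)
        = Real.exp (1 - t) * (p ^ (p - 1) * (t / p) ^ (p - 1)) := by
          rw [← Real.mul_rpow hp0.le (by positivity), mul_div_cancel₀ _ hp0.ne']
      _ ≤ Real.exp (1 - t) * (p ^ (p - 1) * Real.exp (t / p - 1) ^ (p - 1)) := by
          gcongr
      _ = p ^ (p - 1) * (Real.exp (1 - t) * Real.exp ((t / p - 1) * (p - 1))) := by
          rw [← Real.exp_mul]; ring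
      _ = p ^ (p - 1) * Real.exp (2 - p) * Real.exp (-(1 / p) * t) := by
          rw [mul_assoc, ← Real.exp_add, ← Real.exp_add]
          congr 2
          field_simp
          ring
  · rw [integral_const_mul, integral_exp_mul_Ioi hpp, Real.one_rpow, mul_one]
    have h2 : Real.exp (2 - p) * Real.exp (-(1 / p)) ≤ 1 := by
      rw [← Real.exp_add, Real.exp_le_one_iff]
      have : 2 - p + -(1 / p) = -((p - 1) ^ 2 / p) := by field_simp; ring
      rw [this]
      have : 0 ≤ (p - 1) ^ 2 / p := by positivity
      linarith
    have h3 : p ^ (p - 1) * p = p ^ p := by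
      have := Real.rpow_add hp0 (p - 1) 1
      rw [sub_add_cancel, Real.rpow_one] at this
      exact this.symm
    have h4 : 1 + p ≤ (2 : ℝ) ^ p := by
      have := one_add_mul_self_le_rpow_one_add (s := 1) (by norm_num) hp
      rw [mul_one] at this
      norm_num at this
      exact this
    have h5 : 1 ≤ p ^ p := Real.one_le_rpow hp hp0.le
    calc 1 + p * (p ^ (p - 1) * Real.exp (2 - p) * (-Real.exp (-(1 / p)) / -(1 / p)))
        = 1 + p * (p ^ (p - 1) * p) * (Real.exp (2 - p) * Real.exp (-(1 / p))) := by
          field_simp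
      _ ≤ 1 + p * p ^ p * 1 := by rw [h3]; gcongr
      _ ≤ (1 + p) * p ^ p := by linarith
      _ ≤ 2 ^ p * p ^ p := by gcongr
      _ = _ := (Real.mul_rpow zero_le_two hp0.le).symm

theorem lintegral_rpow_le_of_exp_tail {Ω : Type*} [MeasurableSpace Ω] {μ : Measure Ω}
    [IsProbabilityMeasure μ] {X : Ω → ℝ} (hX : Measurable X) (h0 : ∀ x, 0 ≤ X x)
    (tail : ∀ t > 0, μ {x | t ≤ X x} ≤ ENNReal.ofReal (Real.exp (1 - t))) {p : ℝ} (hp : 0 < p) :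
    ∫⁻ x, ENNReal.ofReal (X x ^ p) ∂μ ≤ ENNReal.ofReal ((2 * max 1 p) ^ p) := by
  rcases le_total 1 p with h | h
  · rw [max_eq_right h]
    exact lintegral_rpow_le_of_exp_tail_of_one_le hX h0 tail h
  rw [max_eq_left h]
  have h1 := lintegral_rpow_le_of_exp_tail_of_one_le hX h0 tail le_rfl
  have h2 := eLpNorm'_le_eLpNorm'_of_exponent_le hp h μ hX.aestronglyMeasurable
  have e : ∀ s : ℝ, 0 ≤ s → ∀ x, ‖X x‖ₑ ^ s = ENNReal.ofReal (X x ^ s) := fun s hs x => by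
    rw [Real.enorm_of_nonneg (h0 x), ENNReal.ofReal_rpow_of_nonneg (h0 x) hs]
  simp only [eLpNorm', e p hp.le, e 1 zero_le_one, div_one, ENNReal.rpow_one] at h2
  rw [mul_one, Real.rpow_one] at h1
  have h3 := ENNReal.rpow_le_rpow (h2.trans h1) hp.le
  rw [← ENNReal.rpow_mul, one_div_mul_cancel hp.ne', ENNReal.rpow_one,
    ENNReal.ofReal_rpow_of_nonneg zero_le_two hp.le] at h3
  simpa using h3

theorem lintegral_rpow_le_of_inv_tail {Ω : Type*} [MeasurableSpace Ω] {μ : Measure Ω}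
    [IsProbabilityMeasure μ] {X : Ω → ℝ} (hX : Measurable X) (h0 : ∀ x, 0 ≤ X x) {a : ℝ}
    (ha : 0 < a) (tail : ∀ t > 0, μ {x | t ≤ X x} ≤ ENNReal.ofReal (a / t)) {ρ : ℝ}
    (hρ : 0 < ρ) (hρ1 : ρ < 1) :
    ∫⁻ x, ENNReal.ofReal (X x ^ ρ) ∂μ ≤ ENNReal.ofReal (a ^ ρ / (1 - ρ)) := by
  have hlt : ρ - 2 < -1 := by linarith
  refine (lintegral_rpow_le_of_tail hX h0 hρ ha.le (k := fun t => a * t ^ (ρ - 2))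
    (fun t ht => mul_nonneg ha.le (Real.rpow_nonneg (ha.trans ht).le _)) (fun t ht => ?_)
    ((integrableOn_Ioi_rpow_of_lt hlt ha).const_mul _)).trans (ENNReal.ofReal_le_ofReal ?_)
  · have ht0 : 0 < t := ha.trans ht
    refine (mul_le_mul_left (tail t ht0) _).trans ?_
    rw [← ENNReal.ofReal_mul (div_nonneg ha.le ht0.le)]
    refine (congrArg ENNReal.ofReal ?_).le
    rw [show ρ - 1 = (ρ - 2) + 1 by ring, Real.rpow_add ht0, Real.rpow_one]
    field_simp
  · rw [integral_const_mul, integral_Ioi_rpow_of_lt hlt ha, show ρ - 2 + 1 = ρ - 1 by ring,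
      Real.rpow_sub ha, Real.rpow_one]
    have : 1 - ρ ≠ 0 := by linarith
    have : ρ - 1 ≠ 0 := by linarith
    refine le_of_eq ?_
    field_simp
    ring

theorem integral_le_of_lintegral_ofReal_le {Ω : Type*} [MeasurableSpace Ω] {μ : Measure Ω}
    {f : Ω → ℝ} (hf : Measurable f) (h0 : ∀ x, 0 ≤ f x) {c : ℝ} (hc : 0 ≤ c)
    (h : ∫⁻ x, ENNReal.ofReal (f x) ∂μ ≤ ENNReal.ofReal c) : ∫ x, f x ∂μ ≤ c := by
  rw [integral_eq_lintegral_of_nonneg_ae (ae_of_all _ h0) hf.aestronglyMeasurable]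
  exact ENNReal.toReal_le_of_le_ofReal hc h

/-- A Remez-type distributional inequality implies an inverse Hölder inequality. -/
theorem integral_rpow_mul_integral_rpow_neg_le {Ω : Type*} [MeasurableSpace Ω] {μ : Measure Ω}
    [IsProbabilityMeasure μ] {W : Ω → ℝ} (hW : Measurable W) (h0 : ∀ x, 0 ≤ W x) {A : ℝ}
    (hA : 0 < A) (H : ∀ ε > 0, ∀ c > 0, 0 < μ.real {x | c ≤ W x} →
      μ.real {x | W x ≤ ε} ≤ A * (ε / c) * (1 + Real.log (1 / μ.real {x | c ≤ W x})))
    {p ρ : ℝ} (hp : 0 < p) (hρ : 0 < ρ) (hρ1 : ρ < 1) :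
    (∫ x, W x ^ p ∂μ) ^ (1 / p) * (∫ x, W x ^ (-ρ) ∂μ) ^ (1 / ρ) ≤
      2 * A * max 1 p / (1 - ρ) ^ (1 / ρ) := by
  have hρ' : 0 < 1 - ρ := by linarith
  by_cases hzero : ∀ c > 0, μ.real {x | c ≤ W x} = 0
  · have hae : ∀ᵐ x ∂μ, W x = 0 := by
      have h1 : ∀ n : ℕ, ∀ᵐ x ∂μ, ¬ (1 / ((n : ℝ) + 1) ≤ W x) := fun n => by
        have := hzero (1 / ((n : ℝ) + 1)) (by positivity)
        rw [measureReal_eq_zero_iff] at this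
        exact compl_mem_ae_iff.2 this
      filter_upwards [ae_all_iff.2 h1] with x hx
      refine le_antisymm ?_ (h0 x)
      by_contra! hpos
      obtain ⟨n, hn⟩ := exists_nat_one_div_lt hpos
      exact hx n hn.le
    have : ∫ x, W x ^ p ∂μ = 0 := by
      refine integral_eq_zero_of_ae ?_
      filter_upwards [hae] with x hx
      simp [hx, hp.ne']
    rw [this, Real.zero_rpow (by positivity), zero_mul]
    positivity
  push Not at hzero
  set V : ℝ → ℝ := fun c => μ.real {x | c ≤ W x} with hV
  set S : Set ℝ := {c | 0 < c ∧ 0 < V c} with hS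
  set θ : ℝ → ℝ := fun c => (1 + Real.log (1 / V c)) / c with hθ
  have hV1 : ∀ c, V c ≤ 1 := fun c => measureReal_le_one
  have hθ0 : ∀ c ∈ S, 0 ≤ θ c := fun c hc => by
    have := Real.log_nonneg ((one_le_div hc.2).2 (hV1 c))
    have := hc.1
    positivity
  have hSne : S.Nonempty := by
    obtain ⟨c, hc, hVc⟩ := hzero
    exact ⟨c, hc, measureReal_nonneg.lt_of_ne hVc.symm⟩
  set m := sInf (θ '' S) with hm
  have hbdd : BddBelow (θ '' S) := ⟨0, by rintro _ ⟨c, hc, rfl⟩; exact hθ0 c hc⟩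
  have hmle : ∀ c ∈ S, m ≤ θ c := fun c hc => csInf_le hbdd ⟨c, hc, rfl⟩
  have hlow : ∀ ε > 0, μ.real {x | W x ≤ ε} ≤ A * m * ε := by
    intro ε hε
    have : μ.real {x | W x ≤ ε} / (A * ε) ≤ m := by
      refine le_csInf (hSne.image _) ?_
      rintro _ ⟨c, hc, rfl⟩
      rw [div_le_iff₀ (by positivity)]
      refine (H ε hε c hc.1 hc.2).trans (le_of_eq ?_)
      simp only [hθ, hV]
      ring
    rw [div_le_iff₀ (by positivity)] at this
    linarith
  have hm0 : 0 < m := by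
    by_contra! hneg
    have hnull : ∀ n : ℕ, μ {x | W x ≤ (n : ℝ) + 1} = 0 := fun n => by
      rw [← measureReal_eq_zero_iff]
      refine le_antisymm ((hlow _ (by positivity)).trans ?_) measureReal_nonneg
      have : A * m ≤ 0 := mul_nonpos_of_nonneg_of_nonpos hA.le hneg
      exact mul_nonpos_of_nonpos_of_nonneg this (by positivity)
    have huniv : (⋃ n : ℕ, {x | W x ≤ (n : ℝ) + 1}) = univ := by
      refine eq_univ_of_forall fun x => ?_
      obtain ⟨n, hn⟩ := exists_nat_ge (W x)
      exact mem_iUnion.2 ⟨n, hn.trans (by linarith)⟩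
    have := measure_iUnion_null hnull
    rw [huniv, measure_univ] at this
    exact one_ne_zero this
  have hup : ∀ t > 0, μ {x | t ≤ m * W x} ≤ ENNReal.ofReal (Real.exp (1 - t)) := by
    intro t ht
    have e : {x | t ≤ m * W x} = {x | t / m ≤ W x} := by
      ext x
      simp only [mem_ofPred_eq, div_le_iff₀' hm0]
    rw [e, ← ofReal_measureReal]
    refine ENNReal.ofReal_le_ofReal ?_
    rcases (measureReal_nonneg : 0 ≤ V (t / m)).eq_or_lt with h | h
    · exact h.symm.le.trans (Real.exp_pos _).le
    · have h1 := hmle (t / m) ⟨div_pos ht hm0, h⟩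
      rw [hθ, le_div_iff₀ (div_pos ht hm0), mul_div_cancel₀ _ hm0.ne', one_div, Real.log_inv] at h1
      exact (Real.log_le_iff_le_exp h).1 (by linarith)
  have hmax : 0 < max 1 p := lt_max_of_lt_left one_pos
  have I1 : (∫ x, W x ^ p ∂μ) ^ (1 / p) ≤ 2 * max 1 p / m := by
    have h1 : ∫ x, (m * W x) ^ p ∂μ ≤ (2 * max 1 p) ^ p :=
      integral_le_of_lintegral_ofReal_le ((hW.const_mul m).pow_const p)
        (fun x => Real.rpow_nonneg (mul_nonneg hm0.le (h0 x)) _) (by positivity)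
        (lintegral_rpow_le_of_exp_tail (hW.const_mul m)
          (fun x => mul_nonneg hm0.le (h0 x)) hup hp)
    simp_rw [fun x => Real.mul_rpow (z := p) hm0.le (h0 x)] at h1
    rw [integral_const_mul] at h1
    have h2 : ∫ x, W x ^ p ∂μ ≤ (2 * max 1 p / m) ^ p := by
      rw [Real.div_rpow (by positivity) hm0.le, le_div_iff₀ (by positivity)]
      linarith
    calc _ ≤ ((2 * max 1 p / m) ^ p) ^ (1 / p) :=
          Real.rpow_le_rpow (integral_nonneg fun x => Real.rpow_nonneg (h0 x) _) h2 (by positivity)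
      _ = _ := by rw [← Real.rpow_mul (by positivity), mul_one_div_cancel hp.ne', Real.rpow_one]
  have I2 : (∫ x, W x ^ (-ρ) ∂μ) ^ (1 / ρ) ≤ A * m / (1 - ρ) ^ (1 / ρ) := by
    have hinv : ∀ x, W x ^ (-ρ) = (W x)⁻¹ ^ ρ := fun x => by
      rw [Real.rpow_neg (h0 x), Real.inv_rpow (h0 x)]
    simp_rw [hinv]
    have h1 : ∫ x, (W x)⁻¹ ^ ρ ∂μ ≤ (A * m) ^ ρ / (1 - ρ) := by
      refine integral_le_of_lintegral_ofReal_le (hW.inv.pow_const ρ)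
        (fun x => Real.rpow_nonneg (inv_nonneg.2 (h0 x)) _) (by positivity)
        (lintegral_rpow_le_of_inv_tail hW.inv (fun x => inv_nonneg.2 (h0 x)) (mul_pos hA hm0)
          (fun t ht => ?_) hρ hρ1)
      rw [← ofReal_measureReal]
      refine ENNReal.ofReal_le_ofReal ?_
      refine (measureReal_mono fun x hx => ?_).trans ((hlow (1 / t) (by positivity)).trans
        (le_of_eq (by ring)))
      have hx : t ≤ (W x)⁻¹ := hx
      have hWx : 0 < W x := inv_pos.1 (ht.trans_le hx)
      rw [mem_ofPred_eq, one_div]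
      exact (le_inv_comm₀ ht hWx).1 hx
    calc _ ≤ ((A * m) ^ ρ / (1 - ρ)) ^ (1 / ρ) :=
          Real.rpow_le_rpow (integral_nonneg fun x => Real.rpow_nonneg (inv_nonneg.2 (h0 x)) _) h1
            (by positivity)
      _ = _ := by
          rw [Real.div_rpow (by positivity) hρ'.le, ← Real.rpow_mul (by positivity),
            mul_one_div_cancel hρ.ne', Real.rpow_one]
  calc _ ≤ 2 * max 1 p / m * (A * m / (1 - ρ) ^ (1 / ρ)) :=
        mul_le_mul I1 I2 (Real.rpow_nonneg (integral_nonneg fun x => Real.rpow_nonneg (h0 x) _) _)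
          (by positivity)
    _ = _ := by field_simp

theorem integral_rpow_eval_mul_le {n d : ℕ} {P : MvPolynomial (Fin (n + 1)) ℝ} (hd : 0 < d)
    (hP : P.totalDegree ≤ d) {F : Set (Fin (n + 1) → ℝ)} (hF : IsCompact F)
    (hconv : Convex ℝ F) (hvol : volume F = 1) {q r : ℝ} (hq : 0 < q) (hr0 : 0 < r)
    (hr : r * d < 1) :
    (∫ x in F, |MvPolynomial.eval x P| ^ q) ^ (1 / q) *
      (∫ x in F, |MvPolynomial.eval x P| ^ (-r)) ^ (1 / r) ≤
      (12 * max 1 (q * d)) ^ d / (1 - r * d) ^ (1 / r) := by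
  have hd0 : (0 : ℝ) < d := by exact_mod_cast hd
  have hprob : IsProbabilityMeasure (volume.restrict F) := ⟨by simpa using hvol⟩
  set W : (Fin (n + 1) → ℝ) → ℝ := fun x => |MvPolynomial.eval x P| ^ (1 / d : ℝ) with hWdef
  have hWm : Measurable W :=
    (MvPolynomial.continuous_eval P).abs.measurable.pow_const _
  have hW0 : ∀ x, 0 ≤ W x := fun x => by positivity
  have hWd : ∀ x, W x ^ d = |MvPolynomial.eval x P| := fun x => by
    rw [hWdef, ← Real.rpow_natCast, ← Real.rpow_mul (abs_nonneg _), one_div,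
      inv_mul_cancel₀ hd0.ne', Real.rpow_one]
  have hWs : ∀ (s : ℝ) x, W x ^ (s * d) = |MvPolynomial.eval x P| ^ s := fun s x => by
    rw [mul_comm, Real.rpow_mul (hW0 x), Real.rpow_natCast, hWd]
  have eU : ∀ c : ℝ, 0 < c → (volume.restrict F).real {x | c ≤ W x} =
      volume.real (F ∩ {x | c ^ d ≤ |MvPolynomial.eval x P|}) := fun c hc => by
    rw [measureReal_restrict_apply (measurableSet_le measurable_const hWm), inter_comm]
    congr 2; ext x
    rw [mem_ofPred_eq, mem_ofPred_eq, ← hWd, pow_le_pow_iff_left₀ hc.le (hW0 x) hd.ne']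
  have eL : ∀ c : ℝ, 0 < c → (volume.restrict F).real {x | W x ≤ c} =
      volume.real (F ∩ {x | |MvPolynomial.eval x P| ≤ c ^ d}) := fun c hc => by
    rw [measureReal_restrict_apply (measurableSet_le hWm measurable_const), inter_comm]
    congr 2; ext x
    rw [mem_ofPred_eq, mem_ofPred_eq, ← hWd, pow_le_pow_iff_left₀ (hW0 x) hc.le hd.ne']
  have key := integral_rpow_mul_integral_rpow_neg_le hWm hW0
    (A := 2 * Real.exp 1) (by positivity) (fun ε hε c hc hpos => by
      rw [eU c hc] at hpos ⊢
      rw [eL ε hε]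
      exact volume_real_sublevel_le hd hP hF hconv (by simp [Measure.real, hvol]) hε hc hpos)
    (mul_pos hq hd0) (mul_pos hr0 hd0) hr
  simp only [← neg_mul, hWs] at key
  have hI : ∀ s : ℝ, 0 ≤ ∫ x in F, |MvPolynomial.eval x P| ^ s := fun s =>
    integral_nonneg fun x => by positivity
  have hpow : ∀ {a s : ℝ}, 0 ≤ a → (a ^ (1 / (s * d))) ^ d = a ^ (1 / s) := fun {a s} ha => by
    rw [← Real.rpow_natCast, ← Real.rpow_mul ha]
    congr 1
    field_simp
  have hr1 : 0 ≤ 1 - r * d := sub_nonneg.2 hr.le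
  have key2 := pow_le_pow_left₀ (mul_nonneg (Real.rpow_nonneg (hI _) _)
    (Real.rpow_nonneg (hI _) _)) key d
  rw [mul_pow, hpow (hI _), hpow (hI _), div_pow,
    hpow hr1] at key2
  refine key2.trans ?_
  have he := Real.exp_one_lt_d9
  gcongr
  linarith

end

/-- Inverse Hölder inequality:
`‖P‖_{L^q(F)} · ‖1/P‖_{L^r(F)} ≤ (12 max{1,qd})^d / (1-rd)^{1/r}`
for all `q > 0` and `0 < r < 1/d`. -/
theorem inverse_holder_inequality {n : ℕ} (d : ℕ) (P : MvPolynomial (Fin n) ℝ)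
    (hPd : P.totalDegree ≤ d) (hPnc : ∀ c : ℝ, P ≠ MvPolynomial.C c)
    (F : Set (EuclideanSpace ℝ (Fin n))) (hFcomp : IsCompact F) (hFconv : Convex ℝ F)
    (hFvol : volume F = 1)
    (q r : ℝ) (hq : 0 < q) (hr0 : 0 < r) (hr : r < 1 / (d : ℝ)) :
    (∫ x in F, |MvPolynomial.eval (fun i => x i) P| ^ q) ^ (1 / q) *
      (∫ x in F, |MvPolynomial.eval (fun i => x i) P| ^ (-r)) ^ (1 / r) ≤
      (12 * max 1 (q * d)) ^ d / (1 - r * d) ^ (1 / r) := by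
  have hd : 0 < d := by
    by_contra h
    have hP0 : P.totalDegree = 0 := by omega
    exact hPnc _ (MvPolynomial.totalDegree_eq_zero_iff_eq_C.1 hP0)
  have hd0 : (0 : ℝ) < d := by exact_mod_cast hd
  obtain _ | n := n
  · exact (hPnc _ (MvPolynomial.eq_C_of_isEmpty P)).elim
  let e := EuclideanSpace.equiv (Fin (n + 1)) ℝ
  have hmp : MeasurePreserving (fun x => e.symm x) volume volume :=
    PiLp.volume_preserving_toLp (Fin (n + 1))
  have hemb : MeasurableEmbedding fun x => e.symm x :=
    e.symm.toHomeomorph.measurableEmbedding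
  have himg : (fun x => e.symm x) ⁻¹' F = e '' F := (e.image_eq_preimage_symm F).symm
  have hint : ∀ s : ℝ, ∫ x in F, |MvPolynomial.eval (fun i => x i) P| ^ s =
      ∫ x in e '' F, |MvPolynomial.eval x P| ^ s := fun s => by
    rw [← himg, ← hmp.setIntegral_preimage_emb hemb]
    rfl
  rw [hint, hint]
  refine integral_rpow_eval_mul_le hd hPd (hFcomp.image e.continuous)
    (hFconv.linear_image e.toLinearMap) ?_ hq hr0 ((lt_div_iff₀ hd0).1 hr)
  rw [← himg, hmp.measure_preimage_emb hemb, hFvol]
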